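/- Let n ≥ 4 and let u ∈ C⁴(B₁(0)) be a 2-convex solution of (σ₂/σ₁)(λ(D²u)) = ψ(x,u) in the unit ball B₁(0) ⊂ ℝⁿ, where ψ : B₁(0) × ℝ → (0,∞) is of class C^{1,1}. Assume in addition that u is semi-convex, i.e. there is A > 0 with D²u ≥ −A·Id on B₁(0). Then for all constants M, K, A > 0 there is a constant C > 0 depending only on n, A, ‖ψ‖_{C^{1,1}} ≤ K, ‖1/ψ‖_{L^∞} ≤ K and ‖u‖_{C¹(B₁(0))} ≤ M such that |D²u(0)| ≤ C. -/

import Mathlib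

open Metric Set

/-- The Hessian matrix of `u : ℝⁿ → ℝ` at `x`, with entries the second partial derivatives. -/
noncomputable def hessian (n : ℕ) (u : (Fin n → ℝ) → ℝ) (x : Fin n → ℝ) :
    Matrix (Fin n) (Fin n) ℝ :=
  fun i j => iteratedFDeriv ℝ 2 u x ![Pi.single i 1, Pi.single j 1]

/-- `Δu = σ₁(λ(D²u))`: the trace of the Hessian. -/
noncomputable def lapl (n : ℕ) (u : (Fin n → ℝ) → ℝ) (x : Fin n → ℝ) : ℝ :=
  ∑ i, hessian n u x i i

/-- `σ₂(λ(D²u)) = ((tr D²u)² − tr((D²u)²))/2`, the second elementary symmetric function of the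
eigenvalues of the (symmetric) Hessian. -/
noncomputable def sigma2 (n : ℕ) (u : (Fin n → ℝ) → ℝ) (x : Fin n → ℝ) : ℝ :=
  ((lapl n u x) ^ 2 - ∑ i, ∑ j, hessian n u x i j * hessian n u x j i) / 2

/-- Orthogonal diagonalization data of a real symmetric matrix. -/
structure OrthDiag {n : ℕ} (W : Matrix (Fin n) (Fin n) ℝ) (O : Matrix (Fin n) (Fin n) ℝ)
    (lam : Fin n → ℝ) : Prop where
  left : O.transpose * O = 1
  right : O * O.transpose = 1
  eq : W = O * Matrix.diagonal lam * O.transpose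

theorem exists_orthogonal_diagonalization {n : ℕ} {W : Matrix (Fin n) (Fin n) ℝ}
    (hW : ∀ i j, W i j = W j i) :
    ∃ (O : Matrix (Fin n) (Fin n) ℝ) (lam : Fin n → ℝ), OrthDiag W O lam := by
  have hH : W.IsHermitian := by
    ext i j
    simp [Matrix.conjTranspose_apply, hW i j]
  refine ⟨hH.eigenvectorUnitary, hH.eigenvalues, ?_, ?_, ?_⟩
  · have := Unitary.coe_star_mul_self hH.eigenvectorUnitary
    rwa [Matrix.star_eq_conjTranspose, Matrix.conjTranspose_eq_transpose_of_trivial] at this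
  · refine mul_eq_one_comm.1 ?_
    have := Unitary.coe_star_mul_self hH.eigenvectorUnitary
    rwa [Matrix.star_eq_conjTranspose, Matrix.conjTranspose_eq_transpose_of_trivial] at this
  · have := hH.spectral_theorem
    rw [Unitary.conjStarAlgAut_apply, Matrix.star_eq_conjTranspose,
      Matrix.conjTranspose_eq_transpose_of_trivial] at this
    exact this

/-- A nonnegative matrix product has determinant at most the power of its trace. -/
theorem det_le_trace_pow {n : ℕ} {P : Matrix (Fin n) (Fin n) ℝ} (hP : P.PosSemidef) :
    0 ≤ P.det ∧ P.det ≤ P.trace ^ n := by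
  refine ⟨hP.det_nonneg, ?_⟩
  have h1 := hP.isHermitian.det_eq_prod_eigenvalues
  have h2 := hP.isHermitian.trace_eq_sum_eigenvalues
  simp only [RCLike.ofReal_real_eq_id, id] at h1 h2
  rw [h1, h2]
  calc ∏ i, hP.isHermitian.eigenvalues i
      ≤ ∏ _i : Fin n, ∑ j, hP.isHermitian.eigenvalues j :=
        Finset.prod_le_prod (fun i _ => hP.eigenvalues_nonneg i)
          fun i _ => Finset.single_le_sum (fun j _ => hP.eigenvalues_nonneg j) (Finset.mem_univ i)
    _ = _ := by simp

theorem det_mul_le_trace_pow {n : ℕ} {G N : Matrix (Fin n) (Fin n) ℝ} (hG : G.PosSemidef)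
    (hN : N.PosSemidef) :
    0 ≤ N.det * G.det ∧ N.det * G.det ≤ (G * N).trace ^ n := by
  obtain ⟨B, hB⟩ : ∃ B : Matrix (Fin n) (Fin n) ℝ, G = B.conjTranspose * B := by
    open scoped MatrixOrder in
    obtain ⟨B, hB⟩ := CStarAlgebra.nonneg_iff_eq_star_mul_self.1 hG.nonneg
    exact ⟨B, by rw [hB, Matrix.star_eq_conjTranspose]⟩
  have h := det_le_trace_pow (hN.mul_mul_conjTranspose_same B)
  have h1 : (B * N * B.conjTranspose).det = N.det * G.det := by
    simp only [hB, Matrix.det_mul]; ring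
  have h2 : (B * N * B.conjTranspose).trace = (G * N).trace := by
    rw [hB, Matrix.mul_assoc, Matrix.trace_mul_comm, Matrix.trace_mul_comm (B.conjTranspose * B)]
    simp only [Matrix.mul_assoc]
  rwa [h1, h2] at h

namespace OrthDiag

open Matrix

variable {n : ℕ} {W O : Matrix (Fin n) (Fin n) ℝ} {lam : Fin n → ℝ}

theorem sum_mul (H : OrthDiag W O lam) (v w : Fin n → ℝ) :
    ∑ i, v i * w i = ∑ i, (Oᵀ *ᵥ v) i * (Oᵀ *ᵥ w) i := by
  change v ⬝ᵥ w = (Oᵀ *ᵥ v) ⬝ᵥ (Oᵀ *ᵥ w)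
  rw [Matrix.dotProduct_mulVec, Matrix.vecMul_transpose, Matrix.mulVec_mulVec, H.right,
    Matrix.one_mulVec]

theorem mulVec_mulVec (H : OrthDiag W O lam) (v : Fin n → ℝ) : Oᵀ *ᵥ (O *ᵥ v) = v := by
  rw [Matrix.mulVec_mulVec, H.left, Matrix.one_mulVec]

theorem transpose_mulVec (H : OrthDiag W O lam) (v : Fin n → ℝ) (i : Fin n) :
    (Oᵀ *ᵥ (W *ᵥ v)) i = lam i * (Oᵀ *ᵥ v) i := by
  rw [H.eq, Matrix.mulVec_mulVec, Matrix.mul_assoc, ← Matrix.mul_assoc, H.left, Matrix.one_mul,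
    ← Matrix.mulVec_mulVec, Matrix.mulVec_diagonal]

theorem quad (H : OrthDiag W O lam) (v w : Fin n → ℝ) :
    ∑ i, ∑ j, v i * W i j * w j = ∑ i, lam i * ((Oᵀ *ᵥ v) i * (Oᵀ *ᵥ w) i) := by
  have h1 : ∑ i, ∑ j, v i * W i j * w j = ∑ i, v i * (W *ᵥ w) i := by
    refine Finset.sum_congr rfl fun i _ => ?_
    simp only [Matrix.mulVec, dotProduct, Finset.mul_sum, mul_assoc]
  rw [h1, H.sum_mul]
  refine Finset.sum_congr rfl fun i _ => ?_
  rw [H.transpose_mulVec]; ring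

theorem sum_sq_mulVec (H : OrthDiag W O lam) (v : Fin n → ℝ) :
    ∑ i, (∑ j, W i j * v j) ^ 2 = ∑ i, lam i ^ 2 * (Oᵀ *ᵥ v) i ^ 2 := by
  have h1 : ∑ i, (∑ j, W i j * v j) ^ 2 = ∑ i, (W *ᵥ v) i * (W *ᵥ v) i := by
    refine Finset.sum_congr rfl fun i _ => ?_
    rw [sq]; rfl
  rw [h1, H.sum_mul]
  refine Finset.sum_congr rfl fun i _ => ?_
  rw [H.transpose_mulVec]; ring

theorem trace (H : OrthDiag W O lam) : ∑ i, W i i = ∑ i, lam i := by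
  change W.trace = _
  rw [H.eq, Matrix.mul_assoc, Matrix.trace_mul_comm, Matrix.mul_assoc, H.left, Matrix.mul_one,
    Matrix.trace_diagonal]

theorem det_add (H : OrthDiag W O lam) (c e : ℝ) :
    (c • W + e • (1 : Matrix (Fin n) (Fin n) ℝ)).det = ∏ i, (c * lam i + e) := by
  have h1 : c • W + e • (1 : Matrix (Fin n) (Fin n) ℝ)
      = O * Matrix.diagonal (fun i => c * lam i + e) * Oᵀ := by
    have : Matrix.diagonal (fun i => c * lam i + e)
        = c • Matrix.diagonal lam + e • (1 : Matrix (Fin n) (Fin n) ℝ) := by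
      ext i j
      by_cases h : i = j <;> simp [h, Matrix.diagonal]
    rw [this, Matrix.mul_add, Matrix.add_mul, H.eq]
    simp [H.right]
  rw [h1, Matrix.det_mul, Matrix.det_mul, Matrix.det_diagonal, mul_right_comm, ← Matrix.det_mul,
    H.right, Matrix.det_one, one_mul]

theorem sum_sq (H : OrthDiag W O lam) : ∑ i, ∑ j, W i j ^ 2 = ∑ i, lam i ^ 2 := by
  have h1 : ∑ i, ∑ j, W i j ^ 2 = (W * Wᵀ).trace := by
    simp only [Matrix.trace, Matrix.diag, Matrix.mul_apply, Matrix.transpose_apply, sq]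
  have h2 : W * Wᵀ = O * Matrix.diagonal (fun i => lam i * lam i) * Oᵀ := by
    rw [H.eq]
    simp only [Matrix.transpose_mul, Matrix.transpose_transpose, Matrix.diagonal_transpose]
    calc O * diagonal lam * Oᵀ * (O * (diagonal lam * Oᵀ))
        = O * diagonal lam * (Oᵀ * O) * diagonal lam * Oᵀ := by simp only [Matrix.mul_assoc]
      _ = O * (diagonal lam * diagonal lam) * Oᵀ := by
          rw [H.left, Matrix.mul_one, Matrix.mul_assoc O]
      _ = _ := by rw [Matrix.diagonal_mul_diagonal]
  rw [h1, h2, Matrix.mul_assoc, Matrix.trace_mul_comm, Matrix.mul_assoc, H.left, Matrix.mul_one,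
    Matrix.trace_diagonal]
  simp only [sq]

end OrthDiag

/-- Eigenvalues of a semi-convex Hessian solving `σ₂ / σ₁ = h`, with `s = σ₁`. -/
structure SpecData {n : ℕ} (K A h s : ℝ) (lam : Fin n → ℝ) : Prop where
  hA : 0 ≤ A
  hK : 0 < K
  h_lower : K⁻¹ ≤ h
  h_upper : h ≤ K
  s_pos : 0 < s
  sum_eq : ∑ i, lam i = s
  sum_sq_eq : ∑ i, lam i ^ 2 = s ^ 2 - 2 * h * s
  lower : ∀ i, -A ≤ lam i

namespace SpecData

variable {n : ℕ} {K A h s : ℝ} {lam : Fin n → ℝ}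

theorem h_pos (H : SpecData K A h s lam) : 0 < h :=
  lt_of_lt_of_le (inv_pos.2 H.hK) H.h_lower

theorem two_mul_le (H : SpecData K A h s lam) : 2 * h ≤ s := by
  have h1 : 0 ≤ ∑ i, lam i ^ 2 := Finset.sum_nonneg fun i _ => sq_nonneg _
  rw [H.sum_sq_eq] at h1
  have := H.s_pos
  by_contra! hc
  nlinarith

theorem gap (H : SpecData K A h s lam) (i : Fin n) : h ^ 2 / (2 * s) ≤ s - h - lam i := by
  have h1 : lam i ^ 2 ≤ s ^ 2 - 2 * h * s :=
    H.sum_sq_eq ▸ Finset.single_le_sum (f := fun i => lam i ^ 2) (fun i _ => sq_nonneg _)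
      (Finset.mem_univ i)
  have h2 := H.two_mul_le
  have h3 := H.h_pos
  have h4 := H.s_pos
  have h5 : |lam i| < s - h := abs_lt_of_sq_lt_sq (by nlinarith) (by linarith)
  rw [abs_lt] at h5
  rw [div_le_iff₀ (by positivity)]
  nlinarith

theorem le_top (H : SpecData K A h s lam) (i : Fin n) : s - h - lam i ≤ s + A := by
  have := H.lower i
  have := H.h_pos
  linarith

theorem n_pos (H : SpecData K A h s lam) : 1 ≤ (n : ℝ) := by
  have : n ≠ 0 := by
    rintro rfl
    have := H.sum_eq
    have := H.s_pos
    simp at *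
    linarith
  exact_mod_cast Nat.one_le_iff_ne_zero.2 this

/-- All but one eigenvalue are bounded. -/
theorem exists_index (H : SpecData K A h s lam) :
    ∃ m, s - (2 * K + 2 * n * A) ≤ lam m ∧ ∀ i, i ≠ m → |lam i| ≤ 2 * K + 2 * n * A := by
  have hn := H.n_pos
  have : Nonempty (Fin n) := ⟨⟨0, by exact_mod_cast hn⟩⟩
  obtain ⟨m, hm⟩ := Finite.exists_max lam
  have hA := H.hA
  have hs := H.s_pos
  have hh := H.h_pos
  have hhK := H.h_upper
  have hnA : A ≤ n * A := by nlinarith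
  have h1 : ∑ i, (lam i + A) = s + n * A := by
    rw [Finset.sum_add_distrib, H.sum_eq]; simp
  have h2 : ∑ i, (lam i + A) ^ 2 = s ^ 2 - 2 * h * s + 2 * A * s + n * A ^ 2 := by
    have : ∀ i, (lam i + A) ^ 2 = lam i ^ 2 + (2 * A) * lam i + A ^ 2 := fun i => by ring
    simp only [this, Finset.sum_add_distrib, ← Finset.mul_sum, H.sum_eq, H.sum_sq_eq]
    simp
  have h3 : ∑ i, (lam i + A) ^ 2 ≤ (lam m + A) * ∑ i, (lam i + A) := by
    rw [Finset.mul_sum]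
    refine Finset.sum_le_sum fun i _ => ?_
    have := hm i
    have := H.lower i
    nlinarith
  rw [h1, h2] at h3
  have h4 : s - 2 * h - n * A ≤ lam m + A := by
    by_contra! hc
    have : (lam m + A) * (s + n * A) < (s - 2 * h - n * A) * (s + n * A) := by
      apply mul_lt_mul_of_pos_right hc; nlinarith
    nlinarith [mul_nonneg hA hs.le, mul_nonneg hh.le hA, mul_nonneg (mul_nonneg hh.le hA) (by linarith : (0:ℝ) ≤ n), sq_nonneg (n * A)]
  refine ⟨m, by linarith, fun i hi => ?_⟩
  have h5 : (lam i + A) + (lam m + A) ≤ ∑ j, (lam j + A) := by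
    rw [← Finset.sum_pair (f := fun j => lam j + A) hi]
    exact Finset.sum_le_univ_sum_of_nonneg fun j => by linarith [H.lower j]
  rw [h1] at h5
  rw [abs_le]
  constructor
  · linarith [H.lower i]
  · linarith

private theorem le_prod_of_index {f : Fin n → ℝ} {a c : ℝ} {m : Fin n} (ha : 0 ≤ a) (hc : 0 ≤ c)
    (hm : a ≤ f m) (h : ∀ i, i ≠ m → c ≤ f i) : a * c ^ (n - 1) ≤ ∏ i, f i := by
  rw [← Finset.mul_prod_erase _ _ (Finset.mem_univ m)]
  have h1 : c ^ (n - 1) ≤ ∏ i ∈ Finset.univ.erase m, f i := by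
    calc c ^ (n - 1) = ∏ i ∈ Finset.univ.erase m, c := by simp
      _ ≤ _ := Finset.prod_le_prod (fun _ _ => hc) fun i hi => h i (Finset.ne_of_mem_erase hi)
  exact mul_le_mul hm h1 (by positivity) (ha.trans hm)

theorem prod_gap (H : SpecData K A h s lam) (hs : 2 * (K + (2 * K + 2 * n * A)) ≤ s) :
    h ^ 2 / (2 * s) * (s / 2) ^ (n - 1) ≤ ∏ i, (-1 * lam i + (s - h)) := by
  obtain ⟨m, -, hm⟩ := H.exists_index
  have := H.s_pos
  refine le_prod_of_index (by positivity) (by positivity) (by linarith [H.gap m]) fun i hi => ?_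
  have h1 := abs_le.1 (hm i hi)
  linarith [H.h_upper]

theorem prod_add (H : SpecData K A h s lam) {T : ℝ} (hT : 2 * (2 * K + 2 * n * A) ≤ T) :
    s * (T / 2) ^ (n - 1) ≤ ∏ i, (1 * lam i + T) := by
  obtain ⟨m, h0, hm⟩ := H.exists_index
  have := H.s_pos
  have hL : 0 ≤ 2 * K + 2 * n * A := by have := H.hA; have := H.hK; positivity
  refine le_prod_of_index (m := m) (by positivity) (by linarith) (by linarith) fun i hi => ?_
  have h1 := abs_le.1 (hm i hi)
  linarith

/-- Near-optimality of the largest eigenvalue. -/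
theorem exists_index_gap (H : SpecData K A h s lam) {B : ℝ}
    (hB : B = 4 * (2 * K + 2 * n * A) + 4 * K * (K ^ 2 + n * (2 * K + 2 * n * A) ^ 2))
    (hs : B ≤ s) :
    ∃ m, s - h - lam m ≤ h / 2 ∧ ∀ i, i ≠ m → |lam i| ≤ 2 * K + 2 * n * A := by
  obtain ⟨m, h0, hm⟩ := H.exists_index
  refine ⟨m, ?_, hm⟩
  set Λ := 2 * K + 2 * n * A with hΛ
  have hn := H.n_pos
  have hA := H.hA
  have hK := H.hK
  have hL : 0 ≤ Λ := by positivity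
  have hKL : 2 * K ≤ Λ := by have : 0 ≤ 2 * n * A := by positivity
                             linarith
  have hh := H.h_pos
  have h1 : ∑ i, lam i ^ 2 ≤ lam m ^ 2 + n * Λ ^ 2 := by
    rw [← Finset.add_sum_erase _ _ (Finset.mem_univ m)]
    gcongr
    calc ∑ i ∈ Finset.univ.erase m, lam i ^ 2 ≤ ∑ i ∈ Finset.univ.erase m, Λ ^ 2 := by
          refine Finset.sum_le_sum fun i hi => ?_
          exact sq_le_sq' (abs_le.1 (hm i (Finset.ne_of_mem_erase hi))).1
            (abs_le.1 (hm i (Finset.ne_of_mem_erase hi))).2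
      _ = ((n - 1 : ℕ) : ℝ) * Λ ^ 2 := by simp
      _ ≤ n * Λ ^ 2 := by gcongr; omega
  rw [H.sum_sq_eq] at h1
  set g := s - h - lam m with hg
  have h2 : 0 < g := lt_of_lt_of_le (by have := H.s_pos; positivity) (H.gap m)
  have h3 : g * (s - h + lam m) ≤ h ^ 2 + n * Λ ^ 2 := by rw [hg]; nlinarith
  have h4 : B / 2 ≤ s - h + lam m := by
    have : 0 ≤ 4 * K * (K ^ 2 + n * Λ ^ 2) := by positivity
    linarith [H.h_upper]
  have h5 : h ^ 2 ≤ K ^ 2 := by have := H.h_upper; gcongr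
  by_contra! hc
  have h6 : K⁻¹ / 2 * (B / 2) < g * (s - h + lam m) := by
    have hBp : 0 < B := by rw [hB]; positivity
    calc K⁻¹ / 2 * (B / 2) < g * (B / 2) := by
          apply mul_lt_mul_of_pos_right _ (by positivity)
          linarith [H.h_lower]
      _ ≤ _ := by gcongr
  have h7 : K⁻¹ / 2 * (B / 2) = K⁻¹ * Λ + K ^ 2 + n * Λ ^ 2 := by
    rw [hB]; field_simp; ring
  have h8 : 0 ≤ K⁻¹ * Λ := by positivity
  linarith

end SpecData

section Tensor

open Finset Matrix

variable {n : ℕ}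

theorem sum_swap_left (F : Fin n → Fin n → Fin n → ℝ) :
    ∑ i, ∑ j, ∑ k, F i j k = ∑ i, ∑ j, ∑ k, F j i k := sum_comm

theorem sum_swap_right (F : Fin n → Fin n → Fin n → ℝ) :
    ∑ i, ∑ j, ∑ k, F i j k = ∑ i, ∑ j, ∑ k, F i k j :=
  sum_congr rfl fun _ _ => sum_comm

/-- A symmetric `3`-tensor dominates its projection onto symmetrized products `W ⊗ a`. -/
theorem tensor_sq_lower {W : Matrix (Fin n) (Fin n) ℝ} (hW : ∀ i j, W i j = W j i)
    {T : Fin n → Fin n → Fin n → ℝ} (h12 : ∀ i j k, T i j k = T j i k)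
    (h23 : ∀ i j k, T i j k = T i k j) (a : Fin n → ℝ) :
    2 * ∑ k, a k * (∑ i, ∑ j, W i j * T i j k)
        - ((∑ i, ∑ j, W i j ^ 2) * (∑ k, a k ^ 2) + 2 * ∑ i, (∑ j, W i j * a j) ^ 2) / 3
      ≤ ∑ i, ∑ j, ∑ k, T i j k ^ 2 := by
  have hpos : 0 ≤ ∑ i, ∑ j, ∑ k,
      (T i j k - (W i j * a k + W i k * a j + W j k * a i) / 3) ^ 2 :=
    sum_nonneg fun i _ => sum_nonneg fun j _ => sum_nonneg fun k _ => sq_nonneg _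
  have hexp : ∀ i j k, (T i j k - (W i j * a k + W i k * a j + W j k * a i) / 3) ^ 2
      = T i j k ^ 2 - 2 / 3 * (W i j * a k * T i j k) - 2 / 3 * (W i k * a j * T i j k)
        - 2 / 3 * (W j k * a i * T i j k) + 1 / 9 * (W i j * a k) ^ 2 + 1 / 9 * (W i k * a j) ^ 2
        + 1 / 9 * (W j k * a i) ^ 2 + 2 / 9 * (W i j * a j * (W i k * a k))
        + 2 / 9 * (W i j * a k * (W j k * a i)) + 2 / 9 * (W i k * a j * (W j k * a i)) := by
    intro i j k; ring
  simp only [hexp, sum_add_distrib, sum_sub_distrib, ← mul_sum] at hpos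
  have e1 : ∑ i, ∑ j, ∑ k, W i j * a k * T i j k = ∑ k, a k * (∑ i, ∑ j, W i j * T i j k) := by
    simp only [mul_sum]
    refine (sum_swap_right _).trans ((sum_swap_left _).trans ?_)
    refine sum_congr rfl fun i _ => sum_congr rfl fun j _ => sum_congr rfl fun k _ => ?_
    ring
  have e2 : ∑ i, ∑ j, ∑ k, W i k * a j * T i j k = ∑ i, ∑ j, ∑ k, W i j * a k * T i j k := by
    rw [sum_swap_right]
    exact sum_congr rfl fun i _ => sum_congr rfl fun j _ => sum_congr rfl fun k _ => by
      rw [h23 i k j]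
  have e3 : ∑ i, ∑ j, ∑ k, W j k * a i * T i j k = ∑ i, ∑ j, ∑ k, W i k * a j * T i j k := by
    rw [sum_swap_left]
    exact sum_congr rfl fun i _ => sum_congr rfl fun j _ => sum_congr rfl fun k _ => by
      rw [h12 j i k]
  have e4 : ∑ i, ∑ j, ∑ k, (W i j * a k) ^ 2 = (∑ i, ∑ j, W i j ^ 2) * (∑ k, a k ^ 2) := by
    simp only [mul_pow, ← sum_mul, ← mul_sum]
  have e5 : ∑ i, ∑ j, ∑ k, (W i k * a j) ^ 2 = ∑ i, ∑ j, ∑ k, (W i j * a k) ^ 2 :=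
    sum_swap_right _
  have e6 : ∑ i, ∑ j, ∑ k, (W j k * a i) ^ 2 = ∑ i, ∑ j, ∑ k, (W i k * a j) ^ 2 :=
    sum_swap_left _
  have e7 : ∑ i, ∑ j, ∑ k, W i j * a j * (W i k * a k) = ∑ i, (∑ j, W i j * a j) ^ 2 := by
    simp only [sq, sum_mul_sum]
  have e7' : ∑ i, ∑ j, W i j * a j * ∑ k, W i k * a k = ∑ i, (∑ j, W i j * a j) ^ 2 := by
    simp only [sq, sum_mul]
  have e8 : ∑ i, ∑ j, ∑ k, W i j * a k * (W j k * a i)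
      = ∑ i, ∑ j, ∑ k, W i j * a j * (W i k * a k) := by
    rw [sum_swap_left]
    exact sum_congr rfl fun i _ => sum_congr rfl fun j _ => sum_congr rfl fun k _ => by
      rw [hW j i]; ring
  have e9 : ∑ i, ∑ j, ∑ k, W i k * a j * (W j k * a i)
      = ∑ i, ∑ j, ∑ k, W i j * a k * (W j k * a i) := by
    rw [sum_swap_right]
    exact sum_congr rfl fun i _ => sum_congr rfl fun j _ => sum_congr rfl fun k _ => by
      rw [hW k j]
  rw [e9, e8, e7, e7', e6, e5, e4, e3, e2, e1] at hpos
  linarith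

private theorem scalar_top {t h σ lam y d : ℝ} (hh : 0 < h) (ht : 0 < t) (hσ : σ = t + h)
    (hg0 : 0 ≤ t - lam) (hg : t - lam ≤ h / 2) :
    7 / 6 * ((t - lam) * y ^ 2 / σ) - 16 * d ^ 2 ≤
      2 * t * (y / t) * y - 2 * σ * (y / t) * d - (t ^ 2 - h ^ 2 + 2 * lam ^ 2) * (y / t) ^ 2 / 3
        - y ^ 2 + 2 * d * y := by
  obtain ⟨a, rfl⟩ : ∃ a, y = t * a := ⟨y / t, by field_simp⟩
  obtain ⟨g, rfl⟩ : ∃ g, lam = t - g := ⟨t - lam, by ring⟩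
  rw [mul_div_cancel_left₀ _ ht.ne']
  simp only [sub_sub_cancel] at hg hg0 ⊢
  have h1 : g * (t * a) ^ 2 / σ ≤ g * t * a ^ 2 := by
    rw [div_le_iff₀ (by linarith), hσ]
    nlinarith [mul_nonneg (mul_nonneg hg0 ht.le) (mul_nonneg hh.le (sq_nonneg a))]
  have h2 : g ^ 2 ≤ h ^ 2 / 4 := by nlinarith
  have h3 : g ^ 2 * a ^ 2 ≤ h ^ 2 / 4 * a ^ 2 := by gcongr
  have h4 : 0 ≤ g * t * a ^ 2 := by positivity
  rw [hσ] at h1 ⊢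
  nlinarith [sq_nonneg (h * a - 6 * d), sq_nonneg d]

private theorem scalar_other {t h σ lam Λ y d : ℝ} (hh : 0 < h) (ht : 0 < t) (hσ : σ = t + h)
    (hl : |lam| ≤ Λ) (hΛ : 10 * Λ ≤ t) (hth : 2 * h ≤ t) :
    7 / 6 * ((t - lam) * y ^ 2 / σ) - 16 * d ^ 2 ≤
      2 * t * (2 * y / t) * y - 2 * σ * (2 * y / t) * d
        - (t ^ 2 - h ^ 2 + 2 * lam ^ 2) * (2 * y / t) ^ 2 / 3 - y ^ 2 + 2 * d * y := by
  obtain ⟨a, rfl⟩ : ∃ a, y = t * a / 2 := ⟨2 * y / t, by field_simp⟩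
  have ha : 2 * (t * a / 2) / t = a := by field_simp
  rw [ha]
  have hl' := abs_le.1 hl
  have h1 : (t - lam) * (t * a / 2) ^ 2 / σ ≤ 11 / 40 * (t * a) ^ 2 := by
    rw [div_le_iff₀ (by linarith), hσ]
    have : t - lam ≤ 11 / 10 * (t + h) := by linarith
    nlinarith [mul_nonneg (sub_nonneg.2 this) (sq_nonneg (t * a))]
  have h2 : lam ^ 2 ≤ t ^ 2 / 100 := by nlinarith
  have h3 : lam ^ 2 * a ^ 2 ≤ t ^ 2 / 100 * a ^ 2 := by gcongr
  have h4 : a * d * (t + 2 * h) ≤ (t * a) ^ 2 / 16 + 16 * d ^ 2 := by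
    have h5 : |a * d| * (t + 2 * h) ≤ |a * d| * (2 * t) := by gcongr; linarith
    have h6 : |a * d| * (2 * t) ≤ (t * a) ^ 2 / 16 + 16 * d ^ 2 := by
      rw [abs_mul, ← sq_abs d, mul_pow, ← sq_abs a]
      nlinarith [sq_nonneg (t * |a| / 4 - 4 * |d|)]
    have h7 : a * d * (t + 2 * h) ≤ |a * d| * (t + 2 * h) := by
      gcongr; exact le_abs_self _
    linarith
  rw [hσ] at h1 ⊢
  nlinarith [mul_nonneg (sq_nonneg h) (sq_nonneg a), mul_nonneg (sq_nonneg t) (sq_nonneg a)]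

/-- The size of `σ₁` above which the concavity inequality holds. -/
noncomputable def threshold (n : ℕ) (K A : ℝ) : ℝ :=
  4 * (2 * K + 2 * n * A) + 4 * K * (K ^ 2 + n * (2 * K + 2 * n * A) ^ 2)
    + 11 * (2 * K + 2 * n * A)

/-- Concavity inequality for the third derivatives. -/
theorem concavity {W O : Matrix (Fin n) (Fin n) ℝ} {lam : Fin n → ℝ} {K A h s : ℝ}
    (HO : OrthDiag W O lam) (H : SpecData K A h s lam) (hs : threshold n K A ≤ s)
    (hW : ∀ i j, W i j = W j i)
    {T : Fin n → Fin n → Fin n → ℝ} (h12 : ∀ i j k, T i j k = T j i k)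
    (h23 : ∀ i j k, T i j k = T i k j) {S d : Fin n → ℝ}
    (hc : ∀ k, (s - h) * S k - ∑ i, ∑ j, W i j * T i j k = d k * s) :
    7 / 6 * (((s - h) * ∑ i, S i * S i - ∑ i, ∑ j, S i * W i j * S j) / s) - 16 * ∑ i, d i ^ 2 ≤
      ∑ i, ∑ j, ∑ k, T i j k ^ 2 - ∑ k, S k ^ 2 + 2 * ∑ k, d k * S k := by
  have hK := H.hK
  have hA := H.hA
  have hh := H.h_pos
  have hhK := H.h_upper
  have hΛ : 2 * K ≤ 2 * K + 2 * n * A := by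
    have : 0 ≤ 2 * n * A := by positivity
    linarith
  have hB : 0 ≤ 4 * K * (K ^ 2 + n * (2 * K + 2 * n * A) ^ 2) := by positivity
  rw [threshold] at hs
  obtain ⟨m, hgm, hm⟩ := H.exists_index_gap rfl (by linarith)
  set Λ := 2 * K + 2 * n * A
  set t := s - h with ht
  have htp : 0 < t := by linarith
  set y := Oᵀ *ᵥ S with hy
  set e := Oᵀ *ᵥ d with he
  let p : Fin n → ℝ := fun i => if i = m then y i / t else 2 * y i / t
  have hp : Oᵀ *ᵥ (O *ᵥ p) = p := HO.mulVec_mulVec p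
  set a := O *ᵥ p with ha
  have key := tensor_sq_lower hW h12 h23 a
  have h1 : ∑ k, a k * (∑ i, ∑ j, W i j * T i j k) = t * ∑ k, p k * y k - s * ∑ k, p k * e k := by
    rw [← hp, hy, he, ← HO.sum_mul, ← HO.sum_mul, mul_sum, mul_sum, ← sum_sub_distrib]
    exact sum_congr rfl fun k _ => by linear_combination (-a k) * hc k
  have h2 : ∑ k, a k ^ 2 = ∑ k, p k ^ 2 := by
    simp only [sq]; rw [HO.sum_mul, hp]
  rw [h1, h2, HO.sum_sq, HO.sum_sq_mulVec, hp, H.sum_sq_eq] at key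
  have h3 : ∑ k, S k ^ 2 = ∑ k, y k ^ 2 := by simp only [sq]; rw [HO.sum_mul]
  have h4 : ∑ k, d k ^ 2 = ∑ k, e k ^ 2 := by simp only [sq]; rw [HO.sum_mul]
  have h5 : ∑ i, ∑ j, S i * W i j * S j = ∑ i, lam i * (y i * y i) := HO.quad S S
  rw [h3, h4, h5, HO.sum_mul d S, HO.sum_mul S S]
  have h6 : ∀ i, 7 / 6 * ((t - lam i) * y i ^ 2 / s) - 16 * e i ^ 2 ≤
      2 * t * p i * y i - 2 * s * p i * e i - (t ^ 2 - h ^ 2 + 2 * lam i ^ 2) * p i ^ 2 / 3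
        - y i ^ 2 + 2 * e i * y i := by
    intro i
    by_cases hi : i = m
    · have hg0 : 0 ≤ t - lam i := le_trans (by have := H.s_pos; positivity) (H.gap i)
      have := scalar_top (t := t) (h := h) (σ := s) (lam := lam i) (y := y i) (d := e i) hh htp
        (by linarith) hg0 (hi ▸ hgm)
      simpa only [p, if_pos hi] using this
    · have := scalar_other (t := t) (h := h) (σ := s) (lam := lam i) (y := y i) (d := e i) hh htp
        (by linarith) (hm i hi) (by linarith) (by linarith)
      simpa only [p, if_neg hi] using this
  have h7 := sum_le_sum fun i (_ : i ∈ Finset.univ) => h6 i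
  have e1 : ∑ i, (7 / 6 * ((t - lam i) * y i ^ 2 / s) - 16 * e i ^ 2)
      = 7 / 6 * ((t * ∑ i, y i * y i - ∑ i, lam i * (y i * y i)) / s) - 16 * ∑ i, e i ^ 2 := by
    rw [sum_sub_distrib, ← mul_sum, ← sum_div, ← mul_sum, mul_sum (a := t), ← sum_sub_distrib]
    have : ∀ i, (t - lam i) * y i ^ 2 = t * (y i * y i) - lam i * (y i * y i) := fun i => by ring
    simp only [this]
  have e2 : ∑ i, (2 * t * p i * y i - 2 * s * p i * e i
        - (t ^ 2 - h ^ 2 + 2 * lam i ^ 2) * p i ^ 2 / 3 - y i ^ 2 + 2 * e i * y i)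
      = 2 * (t * ∑ k, p k * y k - s * ∑ k, p k * e k)
        - ((s ^ 2 - 2 * h * s) * ∑ k, p k ^ 2 + 2 * ∑ i, lam i ^ 2 * p i ^ 2) / 3
        - ∑ k, y k ^ 2 + 2 * ∑ k, e k * y k := by
    simp only [mul_sum, ← sum_sub_distrib, ← sum_add_distrib, sum_div]
    exact sum_congr rfl fun i _ => by rw [ht]; ring
  rw [e1, e2] at h7
  linarith

end Tensor

section PartialDerivatives

variable {n : ℕ}

/-- The `i`-th partial derivative. -/
noncomputable def pd (i : Fin n) (f : (Fin n → ℝ) → ℝ) (x : Fin n → ℝ) : ℝ :=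
  fderiv ℝ f x (Pi.single i 1)

/-- `f` is differentiable at `x` with `k`-th partial derivative `f'`. -/
def HasPd (k : Fin n) (f : (Fin n → ℝ) → ℝ) (f' : ℝ) (x : Fin n → ℝ) : Prop :=
  DifferentiableAt ℝ f x ∧ pd k f x = f'

variable {k : Fin n} {f g : (Fin n → ℝ) → ℝ} {f' g' : ℝ} {x : Fin n → ℝ}

theorem DifferentiableAt.hasPd (hf : DifferentiableAt ℝ f x) (k : Fin n) :
    HasPd k f (pd k f x) x := ⟨hf, rfl⟩

theorem HasPd.const (c : ℝ) : HasPd k (fun _ => c) 0 x :=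
  ⟨differentiableAt_const c, by simp [pd]⟩

theorem HasPd.add (hf : HasPd k f f' x) (hg : HasPd k g g' x) :
    HasPd k (fun y => f y + g y) (f' + g') x :=
  ⟨hf.1.add hg.1, by
    rw [← hf.2, ← hg.2, pd, fderiv_fun_add hf.1 hg.1]; rfl⟩

theorem HasPd.sub (hf : HasPd k f f' x) (hg : HasPd k g g' x) :
    HasPd k (fun y => f y - g y) (f' - g') x :=
  ⟨hf.1.sub hg.1, by
    rw [← hf.2, ← hg.2, pd, fderiv_fun_sub hf.1 hg.1]; rfl⟩

theorem HasPd.mul (hf : HasPd k f f' x) (hg : HasPd k g g' x) :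
    HasPd k (fun y => f y * g y) (f' * g x + f x * g') x :=
  ⟨hf.1.mul hg.1, by
    rw [← hf.2, ← hg.2, pd, fderiv_fun_mul hf.1 hg.1]
    simp only [_root_.add_apply, _root_.smul_apply, smul_eq_mul, pd]
    ring⟩

theorem HasPd.const_mul (c : ℝ) (hf : HasPd k f f' x) :
    HasPd k (fun y => c * f y) (c * f') x :=
  ⟨hf.1.const_mul c, by rw [← hf.2, pd, fderiv_const_mul hf.1]; rfl⟩

theorem HasPd.sum {ι : Type*} {s : Finset ι} {F : ι → (Fin n → ℝ) → ℝ} {F' : ι → ℝ}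
    (h : ∀ i, HasPd k (F i) (F' i) x) :
    HasPd k (fun y => ∑ i ∈ s, F i y) (∑ i ∈ s, F' i) x :=
  ⟨DifferentiableAt.fun_sum fun i _ => (h i).1, by
    rw [pd, fderiv_fun_sum fun i _ => (h i).1, _root_.sum_apply]
    exact Finset.sum_congr rfl fun i _ => (h i).2⟩

theorem HasPd.comp {φ : ℝ → ℝ} {φ' : ℝ} (hφ : HasDerivAt φ φ' (f x)) (hf : HasPd k f f' x) :
    HasPd k (fun y => φ (f y)) (φ' * f') x := by
  have h : HasFDerivAt (fun y => φ (f y)) _ x := hφ.comp_hasFDerivAt x hf.1.hasFDerivAt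
  refine ⟨h.differentiableAt, ?_⟩
  rw [← hf.2, pd, h.fderiv]; rfl

theorem HasPd.congr {U : Set (Fin n → ℝ)} (hU : IsOpen U) (hx : x ∈ U) (h : EqOn f g U)
    (hf : HasPd k f f' x) : HasPd k g f' x := by
  have he : g =ᶠ[nhds x] f := Filter.eventuallyEq_of_mem (hU.mem_nhds hx) fun y hy => (h hy).symm
  exact ⟨hf.1.congr_of_eventuallyEq he, by rw [pd, he.fderiv_eq]; exact hf.2⟩

theorem HasPd.unique {f'' : ℝ} (h : HasPd k f f' x) (h' : HasPd k f f'' x) : f' = f'' :=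
  h.2.symm.trans h'.2

theorem pd_congr {U : Set (Fin n → ℝ)} (hU : IsOpen U) (hx : x ∈ U) (h : EqOn f g U) :
    pd k f x = pd k g x := by
  have he : f =ᶠ[nhds x] g := Filter.eventuallyEq_of_mem (hU.mem_nhds hx) h
  rw [pd, he.fderiv_eq]; rfl

theorem ContDiffOn.pd {m l : WithTop ℕ∞} {U : Set (Fin n → ℝ)} (hf : ContDiffOn ℝ m f U)
    (hU : IsOpen U) (h : l + 1 ≤ m) (i : Fin n) : ContDiffOn ℝ l (pd i f) U :=
  (hf.fderiv_of_isOpen hU h).clm_apply contDiffOn_const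

theorem ContDiffOn.differentiableAt_of_isOpen {m : WithTop ℕ∞} {U : Set (Fin n → ℝ)}
    (hf : ContDiffOn ℝ m f U) (hU : IsOpen U) (hm : m ≠ 0) (hx : x ∈ U) :
    DifferentiableAt ℝ f x :=
  (hf.contDiffAt (hU.mem_nhds hx)).differentiableAt hm

theorem pd_pd_eq (hf : ContDiffAt ℝ 2 f x) (i j : Fin n) :
    pd i (pd j f) x = fderiv ℝ (fderiv ℝ f) x (Pi.single i 1) (Pi.single j 1) := by
  have hd : DifferentiableAt ℝ (fderiv ℝ f) x :=
    (hf.fderiv_right (m := 1) (by norm_num)).differentiableAt one_ne_zero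
  have := hd.hasFDerivAt.clm_apply (hasFDerivAt_const (Pi.single j (1 : ℝ) : Fin n → ℝ) x)
  rw [pd]
  change (fderiv ℝ (fun y => fderiv ℝ f y (Pi.single j 1)) x) (Pi.single i 1) = _
  rw [this.fderiv]
  simp

theorem pd_comm (hf : ContDiffAt ℝ 2 f x) (i j : Fin n) :
    pd i (pd j f) x = pd j (pd i f) x := by
  rw [pd_pd_eq hf, pd_pd_eq hf]
  exact (hf.isSymmSndFDerivAt (by simp)).eq _ _

theorem iteratedFDeriv_two_eq_pd_pd (hf : ContDiffAt ℝ 2 f x) (i j : Fin n) :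
    iteratedFDeriv ℝ 2 f x ![Pi.single i 1, Pi.single j 1] = pd i (pd j f) x := by
  rw [pd_pd_eq hf, iteratedFDeriv_two_apply]
  simp

end PartialDerivatives

/-- A semi-convex solution of `|D²u|² = (Δu)² - 2 h Δu` in the unit ball, where `h` plays the role
of `ψ(x, u(x))`, with its structural bounds. -/
structure IsSol (n : ℕ) (K A M L : ℝ) (u h : (Fin n → ℝ) → ℝ) : Prop where
  hK : 0 < K
  hA : 0 ≤ A
  hM : 0 < M
  hL : 0 < L
  u_smooth : ContDiffOn ℝ 4 u (ball 0 1)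
  h_smooth : ContDiffOn ℝ 2 h (ball 0 1)
  h_lower : ∀ x ∈ ball 0 1, K⁻¹ ≤ h x
  h_upper : ∀ x ∈ ball 0 1, h x ≤ K
  lap_pos : ∀ x ∈ ball 0 1, 0 < ∑ i, pd i (pd i u) x
  eqn : ∀ x ∈ ball 0 1, ∑ i, ∑ j, pd i (pd j u) x ^ 2
    = (∑ i, pd i (pd i u) x) ^ 2 - 2 * h x * ∑ i, pd i (pd i u) x
  convex : ∀ x ∈ ball 0 1, ∀ v : Fin n → ℝ,
    -A * ∑ i, v i ^ 2 ≤ ∑ i, ∑ j, v i * pd i (pd j u) x * v j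
  du_le : ∀ x ∈ ball 0 1, ∀ i, |pd i u x| ≤ M
  dh_le : ∀ x ∈ ball 0 1, ∀ i, |pd i h x| ≤ L
  ddh_le : ∀ x ∈ ball 0 1, ∀ i, |pd i (pd i h) x| ≤ L * (1 + |pd i (pd i u) x|)

/-- The Laplacian as a sum of second partial derivatives. -/
noncomputable def lap {n : ℕ} (u : (Fin n → ℝ) → ℝ) (x : Fin n → ℝ) : ℝ := ∑ i, pd i (pd i u) x

namespace IsSol

variable {n : ℕ} {K A M L : ℝ} {u h : (Fin n → ℝ) → ℝ} {x : Fin n → ℝ}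

theorem smooth_pd (H : IsSol n K A M L u h) (i : Fin n) : ContDiffOn ℝ 3 (pd i u) (ball 0 1) :=
  H.u_smooth.pd isOpen_ball (by norm_num) i

theorem smooth_pd_pd (H : IsSol n K A M L u h) (i j : Fin n) :
    ContDiffOn ℝ 2 (pd i (pd j u)) (ball 0 1) :=
  (H.smooth_pd j).pd isOpen_ball (by norm_num) i

theorem smooth_lap (H : IsSol n K A M L u h) : ContDiffOn ℝ 2 (lap u) (ball 0 1) :=
  ContDiffOn.sum fun i _ => H.smooth_pd_pd i i

theorem pd_pd_comm (H : IsSol n K A M L u h) (hx : x ∈ ball 0 1) (i j : Fin n) :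
    pd i (pd j u) x = pd j (pd i u) x :=
  pd_comm ((H.u_smooth.contDiffAt (isOpen_ball.mem_nhds hx)).of_le (by norm_num)) i j

theorem pd_three_swap_left (H : IsSol n K A M L u h) (hx : x ∈ ball 0 1) (i j k : Fin n) :
    pd i (pd j (pd k u)) x = pd j (pd i (pd k u)) x :=
  pd_comm (((H.smooth_pd k).contDiffAt (isOpen_ball.mem_nhds hx)).of_le (by norm_num)) i j

theorem pd_three_swap_right (H : IsSol n K A M L u h) (hx : x ∈ ball 0 1) (i j k : Fin n) :
    pd i (pd j (pd k u)) x = pd i (pd k (pd j u)) x :=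
  pd_congr isOpen_ball hx fun _ hy => H.pd_pd_comm hy j k

theorem pd_lap (H : IsSol n K A M L u h) (hx : x ∈ ball 0 1) (k : Fin n) :
    pd k (lap u) x = ∑ i, pd k (pd i (pd i u)) x :=
  (HasPd.sum fun i => ((H.smooth_pd_pd i i).differentiableAt_of_isOpen isOpen_ball
    (by norm_num) hx).hasPd k).2

theorem smooth_three (H : IsSol n K A M L u h) (i j k : Fin n) :
    ContDiffOn ℝ 1 (pd i (pd j (pd k u))) (ball 0 1) :=
  (H.smooth_pd_pd j k).pd isOpen_ball (by norm_num) i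

theorem pd_pd_lap (H : IsSol n K A M L u h) (hx : x ∈ ball 0 1) (i j : Fin n) :
    pd i (pd j (lap u)) x = ∑ k, pd k (pd k (pd i (pd j u))) x := by
  rw [pd_congr isOpen_ball hx fun y hy => H.pd_lap hy j,
    (HasPd.sum fun k => ((H.smooth_three j k k).differentiableAt_of_isOpen isOpen_ball
      (by norm_num) hx).hasPd i).2]
  refine Finset.sum_congr rfl fun k _ => ?_
  have h1 : ∀ y ∈ ball 0 1, pd j (pd k (pd k u)) y = pd k (pd k (pd j u)) y := fun y hy => by
    rw [H.pd_three_swap_left hy, H.pd_three_swap_right hy]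
  have h2 : ∀ y ∈ ball 0 1, pd i (pd k (pd j u)) y = pd k (pd i (pd j u)) y := fun y hy =>
    H.pd_three_swap_left hy _ _ _
  rw [pd_congr isOpen_ball hx h1, ← pd_congr isOpen_ball hx h2]
  exact pd_comm ((H.smooth_pd_pd k j).contDiffAt (isOpen_ball.mem_nhds hx)) i k

theorem first_variation (H : IsSol n K A M L u h) (hx : x ∈ ball 0 1) (k : Fin n) :
    (lap u x - h x) * pd k (lap u) x - ∑ i, ∑ j, pd i (pd j u) x * pd k (pd i (pd j u)) x
      = pd k h x * lap u x := by
  have hW : ∀ i j, HasPd k (pd i (pd j u)) (pd k (pd i (pd j u)) x) x := fun i j =>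
    ((H.smooth_pd_pd i j).differentiableAt_of_isOpen isOpen_ball (by norm_num) hx).hasPd k
  have hs : HasPd k (lap u) (pd k (lap u) x) x :=
    (H.smooth_lap.differentiableAt_of_isOpen isOpen_ball (by norm_num) hx).hasPd k
  have hh : HasPd k h (pd k h x) x :=
    (H.h_smooth.differentiableAt_of_isOpen isOpen_ball (by norm_num) hx).hasPd k
  have h1 := HasPd.sum (s := Finset.univ) fun i => HasPd.sum (s := Finset.univ) fun j =>
    (hW i j).mul (hW i j)
  have h2 := (hs.mul hs).sub ((hh.mul hs).const_mul 2)
  have h3 := (h1.congr isOpen_ball hx fun y hy => (by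
    have := H.eqn y hy
    simp only [← sq]
    rw [this, lap]; ring : _ = lap u y * lap u y - 2 * (h y * lap u y))).unique h2
  have h4 : ∑ i, ∑ j, (pd k (pd i (pd j u)) x * pd i (pd j u) x
      + pd i (pd j u) x * pd k (pd i (pd j u)) x)
      = 2 * ∑ i, ∑ j, pd i (pd j u) x * pd k (pd i (pd j u)) x := by
    simp only [Finset.mul_sum]
    exact Finset.sum_congr rfl fun i _ => Finset.sum_congr rfl fun j _ => by ring
  rw [h4] at h3
  linarith

theorem second_variation (H : IsSol n K A M L u h) (hx : x ∈ ball 0 1) :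
    (lap u x - h x) * ∑ k, pd k (pd k (lap u)) x
        - ∑ i, ∑ j, pd i (pd j u) x * pd i (pd j (lap u)) x
      = ∑ i, ∑ j, ∑ k, pd i (pd j (pd k u)) x ^ 2 - ∑ k, pd k (lap u) x ^ 2
        + 2 * ∑ k, pd k h x * pd k (lap u) x + lap u x * ∑ k, pd k (pd k h) x := by
  have main : ∀ k, (lap u x - h x) * pd k (pd k (lap u)) x
        - ∑ i, ∑ j, pd i (pd j u) x * pd k (pd k (pd i (pd j u))) x
      = ∑ i, ∑ j, pd k (pd i (pd j u)) x ^ 2 - pd k (lap u) x ^ 2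
        + 2 * (pd k h x * pd k (lap u) x) + lap u x * pd k (pd k h) x := by
    intro k
    have hW : ∀ i j, HasPd k (pd i (pd j u)) (pd k (pd i (pd j u)) x) x := fun i j =>
      ((H.smooth_pd_pd i j).differentiableAt_of_isOpen isOpen_ball (by norm_num) hx).hasPd k
    have hWk : ∀ i j, HasPd k (pd k (pd i (pd j u))) (pd k (pd k (pd i (pd j u))) x) x :=
      fun i j => ((H.smooth_three k i j).differentiableAt_of_isOpen isOpen_ball
        (by norm_num) hx).hasPd k
    have hs : HasPd k (lap u) (pd k (lap u) x) x :=
      (H.smooth_lap.differentiableAt_of_isOpen isOpen_ball (by norm_num) hx).hasPd k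
    have hh : HasPd k h (pd k h x) x :=
      (H.h_smooth.differentiableAt_of_isOpen isOpen_ball (by norm_num) hx).hasPd k
    have hsk : HasPd k (pd k (lap u)) (pd k (pd k (lap u)) x) x :=
      ((H.smooth_lap.pd (l := 1) isOpen_ball (by norm_num) k).differentiableAt_of_isOpen isOpen_ball
        (by norm_num) hx).hasPd k
    have hhk : HasPd k (pd k h) (pd k (pd k h) x) x :=
      ((H.h_smooth.pd (l := 1) isOpen_ball (by norm_num) k).differentiableAt_of_isOpen isOpen_ball
        (by norm_num) hx).hasPd k
    have h1 := ((hs.sub hh).mul hsk).sub (HasPd.sum (s := Finset.univ) fun i =>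
      HasPd.sum (s := Finset.univ) fun j => (hW i j).mul (hWk i j))
    have h3 := (h1.congr isOpen_ball hx fun y hy => H.first_variation hy k).unique (hhk.mul hs)
    simp only [Finset.sum_add_distrib, ← sq] at h3
    linarith
  have h1 := Finset.sum_congr rfl fun k (_ : k ∈ Finset.univ) => main k
  simp only [Finset.sum_add_distrib, Finset.sum_sub_distrib, ← Finset.mul_sum] at h1
  have h2 : ∑ k, ∑ i, ∑ j, pd i (pd j u) x * pd k (pd k (pd i (pd j u))) x
      = ∑ i, ∑ j, pd i (pd j u) x * pd i (pd j (lap u)) x := by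
    rw [sum_swap_left, sum_swap_right]
    refine Finset.sum_congr rfl fun i _ => Finset.sum_congr rfl fun j _ => ?_
    rw [H.pd_pd_lap hx, Finset.mul_sum]
  rw [h2] at h1
  exact h1

end IsSol

/-- The linearized operator `(σ₁ - h) I - D²u`. -/
noncomputable def gmat {n : ℕ} (u h : (Fin n → ℝ) → ℝ) (x : Fin n → ℝ) :
    Matrix (Fin n) (Fin n) ℝ :=
  fun i j => (1 : Matrix (Fin n) (Fin n) ℝ) i j * (lap u x - h x) - pd i (pd j u) x

/-- The logarithm of the Laplacian. -/
noncomputable def logLap {n : ℕ} (u : (Fin n → ℝ) → ℝ) (x : Fin n → ℝ) : ℝ := Real.log (lap u x)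

namespace IsSol

variable {n : ℕ} {K A M L : ℝ} {u h : (Fin n → ℝ) → ℝ} {x : Fin n → ℝ}

theorem exists_spec (H : IsSol n K A M L u h) (hx : x ∈ ball 0 1) :
    ∃ O lam, OrthDiag (Matrix.of fun i j => pd i (pd j u) x) O lam ∧ SpecData K A (h x) (lap u x) lam := by
  obtain ⟨O, lam, hO⟩ := exists_orthogonal_diagonalization
    (W := Matrix.of fun i j => pd i (pd j u) x) fun i j => H.pd_pd_comm hx i j
  refine ⟨O, lam, hO, H.hA, H.hK, H.h_lower x hx, H.h_upper x hx, H.lap_pos x hx,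
    hO.trace.symm, ?_, fun i => ?_⟩
  · rw [← hO.sum_sq]; exact H.eqn x hx
  · have h1 := H.convex x hx (O.mulVec (Pi.single i 1))
    have h3 : ∑ k, ∑ j, O.mulVec (Pi.single i 1) k * pd k (pd j u) x * O.mulVec (Pi.single i 1) j
        = _ := hO.quad _ _
    rw [h3] at h1
    have h2 := hO.sum_mul (O.mulVec (Pi.single i 1)) (O.mulVec (Pi.single i 1))
    simp only [← sq] at h2
    rw [h2] at h1
    rw [hO.mulVec_mulVec] at h1
    simpa [Pi.single_apply] using h1

theorem gmat_sum (X : Fin n → Fin n → ℝ) :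
    ∑ i, ∑ j, gmat u h x i j * X i j
      = (lap u x - h x) * ∑ i, X i i - ∑ i, ∑ j, pd i (pd j u) x * X i j := by
  have h1 : ∀ i j, gmat u h x i j * X i j
      = (1 : Matrix (Fin n) (Fin n) ℝ) i j * (lap u x - h x) * X i j - pd i (pd j u) x * X i j :=
    fun i j => by rw [gmat, sub_mul]
  simp only [h1, Finset.sum_sub_distrib, Finset.mul_sum]
  refine congrArg₂ _ (Finset.sum_congr rfl fun i _ => ?_) rfl
  rw [Finset.sum_eq_single i]
  · simp
  · intro j _ hj; simp [Matrix.one_apply_ne hj.symm]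
  · simp

theorem gmat_quad {O : Matrix (Fin n) (Fin n) ℝ} {lam : Fin n → ℝ}
    (hO : OrthDiag (Matrix.of fun i j => pd i (pd j u) x) O lam) (v : Fin n → ℝ) :
    ∑ i, ∑ j, gmat u h x i j * (v i * v j)
      = ∑ i, (lap u x - h x - lam i) * (O.transpose.mulVec v) i ^ 2 := by
  have h1 : ∑ i, ∑ j, v i * pd i (pd j u) x * v j = _ := hO.quad v v
  have h2 := hO.sum_mul v v
  rw [gmat_sum, h2]
  have h3 : ∑ i, ∑ j, pd i (pd j u) x * (v i * v j) = ∑ i, ∑ j, v i * pd i (pd j u) x * v j :=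
    Finset.sum_congr rfl fun i _ => Finset.sum_congr rfl fun j _ => by ring
  rw [h3, h1, Finset.mul_sum, ← Finset.sum_sub_distrib]
  exact Finset.sum_congr rfl fun i _ => by ring

theorem two_le_lap (H : IsSol n K A M L u h) (hx : x ∈ ball 0 1) : 2 ≤ K * lap u x := by
  obtain ⟨O, lam, hO, hS⟩ := H.exists_spec hx
  have h1 := hS.two_mul_le
  have h2 := hS.h_lower
  have h3 := H.hK
  calc (2 : ℝ) = K * (2 * K⁻¹) := by field_simp
    _ ≤ K * lap u x := by gcongr; linarith

theorem lap_pos' (H : IsSol n K A M L u h) (hx : x ∈ ball 0 1) : 0 < lap u x := H.lap_pos x hx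

theorem norm_sq_le_gmat (H : IsSol n K A M L u h) (hx : x ∈ ball 0 1) (v : Fin n → ℝ) :
    ∑ i, v i ^ 2 ≤ 2 * K ^ 2 * lap u x * ∑ i, ∑ j, gmat u h x i j * (v i * v j) := by
  obtain ⟨O, lam, hO, hS⟩ := H.exists_spec hx
  have hK := H.hK
  have hs := hS.s_pos
  have h2 := hO.sum_mul v v
  simp only [← sq] at h2
  rw [gmat_quad hO, Finset.mul_sum, h2]
  refine Finset.sum_le_sum fun i _ => ?_
  rw [← mul_assoc]
  refine le_mul_of_one_le_left (sq_nonneg _) ?_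
  have h1 := hS.gap i
  have h3 : 1 ≤ K * h x := by
    calc (1 : ℝ) = K * K⁻¹ := by field_simp
      _ ≤ K * h x := by gcongr; exact hS.h_lower
  calc (1 : ℝ) ≤ (K * h x) ^ 2 := one_le_pow₀ h3
    _ = 2 * K ^ 2 * lap u x * (h x ^ 2 / (2 * lap u x)) := by field_simp
    _ ≤ _ := by gcongr

theorem gmat_quad_nonneg (H : IsSol n K A M L u h) (hx : x ∈ ball 0 1) (v : Fin n → ℝ) :
    0 ≤ ∑ i, ∑ j, gmat u h x i j * (v i * v j) := by
  obtain ⟨O, lam, hO, hS⟩ := H.exists_spec hx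
  have hs := hS.s_pos
  rw [gmat_quad hO]
  exact Finset.sum_nonneg fun i _ =>
    mul_nonneg (le_trans (by positivity) (hS.gap i)) (sq_nonneg _)

theorem gmat_quad_le (H : IsSol n K A M L u h) (hx : x ∈ ball 0 1) (v : Fin n → ℝ) :
    ∑ i, ∑ j, gmat u h x i j * (v i * v j) ≤ (lap u x + A) * ∑ i, v i ^ 2 := by
  obtain ⟨O, lam, hO, hS⟩ := H.exists_spec hx
  have h2 := hO.sum_mul v v
  simp only [← sq] at h2
  rw [gmat_quad hO, h2, Finset.mul_sum]
  exact Finset.sum_le_sum fun i _ => mul_le_mul_of_nonneg_right (hS.le_top i) (sq_nonneg _)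

theorem gmat_symm (H : IsSol n K A M L u h) (hx : x ∈ ball 0 1) (i j : Fin n) :
    gmat u h x i j = gmat u h x j i := by
  rw [gmat, gmat, H.pd_pd_comm hx, ← Matrix.transpose_apply (1 : Matrix (Fin n) (Fin n) ℝ),
    Matrix.transpose_one]

theorem gmat_posSemidef (H : IsSol n K A M L u h) (hx : x ∈ ball 0 1) :
    (gmat u h x).PosSemidef := by
  refine Matrix.PosSemidef.of_dotProduct_mulVec_nonneg ?_ fun v => ?_
  · ext i j; simpa [Matrix.conjTranspose_apply] using H.gmat_symm hx j i
  · have h1 := H.gmat_quad_nonneg hx v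
    refine h1.trans_eq ?_
    simp only [dotProduct, Matrix.mulVec, Finset.mul_sum, Pi.star_apply, star_trivial]
    exact Finset.sum_congr rfl fun i _ => Finset.sum_congr rfl fun j _ => by ring

/-- Cauchy-Schwarz for the linearized operator. -/
theorem two_mul_gmat_le (H : IsSol n K A M L u h) (hx : x ∈ ball 0 1) (v w : Fin n → ℝ) :
    -(2 * ∑ i, ∑ j, gmat u h x i j * (v i * w j))
      ≤ ∑ i, ∑ j, gmat u h x i j * (v i * v j) + ∑ i, ∑ j, gmat u h x i j * (w i * w j) := by
  have h1 := H.gmat_quad_nonneg hx (fun i => v i + w i)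
  have h2 : ∑ i, ∑ j, gmat u h x i j * ((v i + w i) * (v j + w j))
      = ∑ i, ∑ j, gmat u h x i j * (v i * v j) + ∑ i, ∑ j, gmat u h x i j * (w i * w j)
        + (∑ i, ∑ j, gmat u h x i j * (v i * w j) + ∑ i, ∑ j, gmat u h x i j * (w i * v j)) := by
    simp only [← Finset.sum_add_distrib]
    exact Finset.sum_congr rfl fun i _ => Finset.sum_congr rfl fun j _ => by ring
  have h3 : ∑ i, ∑ j, gmat u h x i j * (w i * v j) = ∑ i, ∑ j, gmat u h x i j * (v i * w j) := by
    rw [Finset.sum_comm]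
    exact Finset.sum_congr rfl fun i _ => Finset.sum_congr rfl fun j _ => by
      rw [H.gmat_symm hx]; ring
  rw [h2, h3] at h1
  linarith

theorem det_gmat_ge (H : IsSol n K A M L u h) (hx : x ∈ ball 0 1)
    (hs : 2 * (K + (2 * K + 2 * n * A)) ≤ lap u x) :
    (2 * K ^ 2 * lap u x)⁻¹ * (lap u x / 2) ^ (n - 1) ≤ (gmat u h x).det := by
  obtain ⟨O, lam, hO, hS⟩ := H.exists_spec hx
  have h1 : gmat u h x = (-1 : ℝ) • (Matrix.of fun i j => pd i (pd j u) x)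
      + (lap u x - h x) • (1 : Matrix (Fin n) (Fin n) ℝ) := by
    ext i j; simp [gmat]; ring
  rw [h1, OrthDiag.det_add hO]
  refine le_trans ?_ (hS.prod_gap hs)
  have hK := H.hK
  have hl := hS.s_pos
  have hh : K⁻¹ ^ 2 ≤ h x ^ 2 := by gcongr; exact hS.h_lower
  gcongr
  calc (2 * K ^ 2 * lap u x)⁻¹ = K⁻¹ ^ 2 / (2 * lap u x) := by field_simp
    _ ≤ _ := by gcongr

theorem det_hess_add_ge (H : IsSol n K A M L u h) (hx : x ∈ ball 0 1) {T : ℝ}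
    (hT : 2 * (2 * K + 2 * n * A) ≤ T) :
    lap u x * (T / 2) ^ (n - 1)
      ≤ ((Matrix.of fun i j => pd i (pd j u) x) + T • (1 : Matrix (Fin n) (Fin n) ℝ)).det := by
  obtain ⟨O, lam, hO, hS⟩ := H.exists_spec hx
  have h1 := OrthDiag.det_add hO 1 T
  rw [one_smul] at h1
  rw [h1]
  exact hS.prod_add hT

theorem abs_hess_le (H : IsSol n K A M L u h) (hx : x ∈ ball 0 1) (i j : Fin n) :
    |pd i (pd j u) x| ≤ lap u x := by
  have hl := H.lap_pos' hx
  have h0 : 0 ≤ h x := (inv_pos.2 H.hK).le.trans (H.h_lower x hx)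
  refine abs_le_of_sq_le_sq ?_ hl.le
  have h1 : pd i (pd j u) x ^ 2 ≤ ∑ i, ∑ j, pd i (pd j u) x ^ 2 :=
    (Finset.single_le_sum (f := fun j => pd i (pd j u) x ^ 2) (fun _ _ => sq_nonneg _)
      (Finset.mem_univ j)).trans
    (Finset.single_le_sum (f := fun i => ∑ j, pd i (pd j u) x ^ 2)
      (fun _ _ => Finset.sum_nonneg fun _ _ => sq_nonneg _) (Finset.mem_univ i))
  rw [H.eqn x hx] at h1
  change _ ≤ lap u x ^ 2 - 2 * h x * lap u x at h1
  nlinarith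

theorem gmat_third (H : IsSol n K A M L u h) (hx : x ∈ ball 0 1) (k : Fin n) :
    ∑ i, ∑ j, gmat u h x i j * pd k (pd i (pd j u)) x = pd k h x * lap u x := by
  rw [gmat_sum, ← H.pd_lap hx, H.first_variation hx]

theorem hasPd_gmat (H : IsSol n K A M L u h) (hx : x ∈ ball 0 1) (i j k : Fin n) :
    HasPd k (fun y => gmat u h y i j) ((1 : Matrix (Fin n) (Fin n) ℝ) i j *
      (pd k (lap u) x - pd k h x) - pd k (pd i (pd j u)) x) x := by
  have hW : HasPd k (pd i (pd j u)) (pd k (pd i (pd j u)) x) x :=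
    ((H.smooth_pd_pd i j).differentiableAt_of_isOpen isOpen_ball (by norm_num) hx).hasPd k
  have hs : HasPd k (lap u) (pd k (lap u) x) x :=
    (H.smooth_lap.differentiableAt_of_isOpen isOpen_ball (by norm_num) hx).hasPd k
  have hh : HasPd k h (pd k h x) x :=
    (H.h_smooth.differentiableAt_of_isOpen isOpen_ball (by norm_num) hx).hasPd k
  exact ((hs.sub hh).const_mul _).sub hW

theorem div_gmat (H : IsSol n K A M L u h) (hx : x ∈ ball 0 1) (j : Fin n) :
    ∑ i, pd i (fun y => gmat u h y i j) x = -pd j h x := by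
  simp only [(H.hasPd_gmat hx _ _ _).2, Finset.sum_sub_distrib]
  have h1 : ∑ i, (1 : Matrix (Fin n) (Fin n) ℝ) i j * (pd i (lap u) x - pd i h x)
      = pd j (lap u) x - pd j h x := by
    rw [Finset.sum_eq_single j]
    · simp
    · intro i _ hi; simp [Matrix.one_apply_ne hi]
    · simp
  have h2 : ∑ i, pd i (pd i (pd j u)) x = pd j (lap u) x := by
    rw [H.pd_lap hx]
    refine Finset.sum_congr rfl fun i _ => ?_
    rw [H.pd_three_swap_right hx, H.pd_three_swap_left hx]
  rw [h1, h2]; ring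

theorem smooth_logLap (H : IsSol n K A M L u h) : ContDiffOn ℝ 2 (logLap u) (ball 0 1) :=
  H.smooth_lap.log fun _ hx => (H.lap_pos' hx).ne'

theorem hasPd_logLap (H : IsSol n K A M L u h) (hx : x ∈ ball 0 1) (i : Fin n) :
    HasPd i (logLap u) ((lap u x)⁻¹ * pd i (lap u) x) x :=
  HasPd.comp (Real.hasDerivAt_log (H.lap_pos' hx).ne')
    ((H.smooth_lap.differentiableAt_of_isOpen isOpen_ball (by norm_num) hx).hasPd i)

theorem pd_pd_logLap (H : IsSol n K A M L u h) (hx : x ∈ ball 0 1) (i j : Fin n) :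
    pd i (pd j (logLap u)) x = (lap u x)⁻¹ * pd i (pd j (lap u)) x
      - pd i (logLap u) x * pd j (logLap u) x := by
  have hl := H.lap_pos' hx
  have h1 : HasPd i (fun y => (lap u y)⁻¹ * pd j (lap u) y) _ x :=
    (HasPd.comp (hasDerivAt_inv hl.ne')
      ((H.smooth_lap.differentiableAt_of_isOpen isOpen_ball (by norm_num) hx).hasPd i)).mul
    (((H.smooth_lap.pd (l := 1) isOpen_ball (by norm_num) j).differentiableAt_of_isOpen isOpen_ball
        (by norm_num) hx).hasPd i)
  rw [pd_congr isOpen_ball hx fun y hy => (H.hasPd_logLap hy j).2, h1.2,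
    (H.hasPd_logLap hx i).2, (H.hasPd_logLap hx j).2]
  field_simp
  ring

/-- Jacobi inequality for the logarithm of the Laplacian. -/
theorem jacobi (H : IsSol n K A M L u h) (hx : x ∈ ball 0 1)
    (hs : threshold n K A ≤ lap u x) :
    1 / 6 * (∑ i, ∑ j, gmat u h x i j * (pd i (logLap u) x * pd j (logLap u) x))
        - (4 * n * L ^ 2 * K ^ 2 + n * L * (K + 1)) * lap u x
      ≤ ∑ i, ∑ j, gmat u h x i j * pd i (pd j (logLap u)) x := by
  obtain ⟨O, lam, hO, hS⟩ := H.exists_spec hx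
  have hl := H.lap_pos' hx
  have hK := H.hK
  have hL := H.hL
  have h2K := H.two_le_lap hx
  have hc := concavity hO hS hs (fun i j => H.pd_pd_comm hx i j)
    (T := fun i j k => pd i (pd j (pd k u)) x) (S := fun k => pd k (lap u) x)
    (d := fun k => pd k h x) (fun i j k => H.pd_three_swap_left hx i j k)
    (fun i j k => H.pd_three_swap_right hx i j k) fun k => by
      rw [← H.first_variation hx k]
      simp only [Matrix.of_apply]
      congr 1
      refine Finset.sum_congr rfl fun i _ => Finset.sum_congr rfl fun j _ => ?_
      rw [H.pd_three_swap_right hx i j k, H.pd_three_swap_left hx i k j]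
  have hv := H.second_variation hx
  have e1 : ∑ i, ∑ j, gmat u h x i j * (pd i (lap u) x * pd j (lap u) x)
      = (lap u x - h x) * ∑ i, pd i (lap u) x * pd i (lap u) x
        - ∑ i, ∑ j, pd i (lap u) x * pd i (pd j u) x * pd j (lap u) x := by
    rw [gmat_sum]
    congr 1
    exact Finset.sum_congr rfl fun i _ => Finset.sum_congr rfl fun j _ => by ring
  simp only [Matrix.of_apply] at hc
  rw [← e1] at hc
  rw [← gmat_sum (X := fun i j => pd i (pd j (lap u)) x)] at hv
  have e2 : ∑ i, ∑ j, gmat u h x i j * (pd i (logLap u) x * pd j (logLap u) x)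
      = (∑ i, ∑ j, gmat u h x i j * (pd i (lap u) x * pd j (lap u) x)) / lap u x / lap u x := by
    simp only [Finset.sum_div]
    refine Finset.sum_congr rfl fun i _ => Finset.sum_congr rfl fun j _ => ?_
    rw [(H.hasPd_logLap hx i).2, (H.hasPd_logLap hx j).2]
    field_simp
  have e3 : ∑ i, ∑ j, gmat u h x i j * pd i (pd j (logLap u)) x
      = (∑ i, ∑ j, gmat u h x i j * pd i (pd j (lap u)) x) / lap u x
        - ∑ i, ∑ j, gmat u h x i j * (pd i (logLap u) x * pd j (logLap u) x) := by
    simp only [Finset.sum_div, ← Finset.sum_sub_distrib]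
    refine Finset.sum_congr rfl fun i _ => Finset.sum_congr rfl fun j _ => ?_
    rw [H.pd_pd_logLap hx]
    field_simp
  set Q := ∑ i, ∑ j, gmat u h x i j * (pd i (lap u) x * pd j (lap u) x)
  set P := ∑ i, ∑ j, gmat u h x i j * pd i (pd j (lap u)) x
  have h1 : ∑ k, pd k h x ^ 2 ≤ n * L ^ 2 := by
    calc ∑ k, pd k h x ^ 2 ≤ ∑ _k : Fin n, L ^ 2 := Finset.sum_le_sum fun k _ => by
          rw [← sq_abs]; gcongr; exact H.dh_le x hx k
      _ = n * L ^ 2 := by simp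
  have h2 : -(n * (L * (1 + lap u x))) ≤ ∑ k, pd k (pd k h) x := by
    calc -(n * (L * (1 + lap u x))) = ∑ _k : Fin n, -(L * (1 + lap u x)) := by simp
      _ ≤ _ := Finset.sum_le_sum fun k _ => by
          refine (neg_le_neg ?_).trans (neg_abs_le _)
          refine (H.ddh_le x hx k).trans ?_
          gcongr
          exact H.abs_hess_le hx k k
  have h3 : 7 / 6 * (Q / lap u x) - 16 * (n * L ^ 2) - lap u x * (n * (L * (1 + lap u x))) ≤ P := by
    have := mul_le_mul_of_nonneg_left h2 hl.le
    linarith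
  have h4 : (7 / 6 * (Q / lap u x) - 16 * (n * L ^ 2) - lap u x * (n * (L * (1 + lap u x))))
      / lap u x ≤ P / lap u x := by gcongr
  have h5 : (7 / 6 * (Q / lap u x) - 16 * (n * L ^ 2) - lap u x * (n * (L * (1 + lap u x))))
      / lap u x = 7 / 6 * (Q / lap u x / lap u x) - 16 * (n * L ^ 2) * (lap u x)⁻¹
        - n * (L * (1 + lap u x)) := by field_simp
  have h6 : (lap u x)⁻¹ ≤ K ^ 2 * lap u x / 4 := by
    rw [inv_le_iff_one_le_mul₀ hl]
    nlinarith
  have h7 : 16 * (n * L ^ 2) * (lap u x)⁻¹ ≤ 16 * (n * L ^ 2) * (K ^ 2 * lap u x / 4) := by gcongr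
  have h8 : (n : ℝ) * L * 1 ≤ n * L * (K * lap u x) := by gcongr; linarith
  rw [e2] at e3 ⊢
  rw [e3]
  linarith

end IsSol

section Cutoff

open MeasureTheory

/-- A smooth cutoff equal to `1` on the ball of radius `r` and vanishing off the ball of radius
`R`, with derivatives bounded by `P`. -/
structure Cutoff (n : ℕ) (r R P : ℝ) (φ : (Fin n → ℝ) → ℝ) : Prop where
  smooth : ContDiff ℝ 3 φ
  nonneg : ∀ x, 0 ≤ φ x
  le_one : ∀ x, φ x ≤ 1
  eq_one : ∀ x ∈ closedBall 0 r, φ x = 1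
  eq_zero : ∀ x ∉ closedBall 0 R, φ x = 0
  P_pos : 0 < P
  pd_le : ∀ x i, |pd i φ x| ≤ P
  pd_pd_le : ∀ x i j, |pd i (pd j φ) x| ≤ P

theorem pd_eq_zero_of_notMem {n : ℕ} {f : (Fin n → ℝ) → ℝ} {R : ℝ}
    (hf : ∀ x ∉ closedBall 0 R, f x = 0) (i : Fin n) {x : Fin n → ℝ} (hx : x ∉ closedBall 0 R) :
    pd i f x = 0 := by
  rw [pd_congr (g := fun _ => 0) isClosed_closedBall.isOpen_compl hx fun y hy => hf y hy]
  exact (HasPd.const 0).2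

theorem contDiff_pd {n : ℕ} {f : (Fin n → ℝ) → ℝ} {m l : WithTop ℕ∞} (hf : ContDiff ℝ m f)
    (h : l + 1 ≤ m) (i : Fin n) : ContDiff ℝ l (pd i f) :=
  contDiffOn_univ.1 ((contDiffOn_univ.2 hf).pd isOpen_univ h i)

theorem exists_bound_of_eq_zero {n : ℕ} {f : (Fin n → ℝ) → ℝ} {R : ℝ} (hc : Continuous f)
    (hf : ∀ x ∉ closedBall 0 R, f x = 0) : ∃ P, 0 ≤ P ∧ ∀ x, |f x| ≤ P := by
  obtain ⟨C, hC⟩ := (isCompact_closedBall (0 : Fin n → ℝ) R).exists_bound_of_continuousOn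
    hc.continuousOn
  refine ⟨max C 0, le_max_right _ _, fun x => ?_⟩
  by_cases hx : x ∈ closedBall 0 R
  · exact (hC x hx).trans (le_max_left _ _)
  · simp [hf x hx]

theorem exists_cutoff (n : ℕ) {r R : ℝ} (hr : 0 < r) (hR : r < R) :
    ∃ P φ, Cutoff n r R P φ := by
  let φ : ContDiffBump (0 : Fin n → ℝ) := ⟨r, R, hr, hR⟩
  have h0 : ∀ x ∉ closedBall 0 R, φ x = 0 := fun x hx => by
    refine φ.zero_of_le_dist (le_of_not_ge fun h => hx h)
  have hs : ContDiff ℝ 3 φ := φ.contDiff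
  have h1 : ∀ i, ∀ x ∉ closedBall 0 R, pd i φ x = 0 := fun i x hx => pd_eq_zero_of_notMem h0 i hx
  choose P1 hP1 hP1' using fun i => exists_bound_of_eq_zero
    (contDiff_pd (l := 2) hs (by norm_num) i).continuous (h1 i)
  choose P2 hP2 hP2' using fun (i j : Fin n) => exists_bound_of_eq_zero
    (contDiff_pd (l := 1) (contDiff_pd (l := 2) hs (by norm_num) j) (by norm_num) i).continuous
    fun x hx => pd_eq_zero_of_notMem (h1 j) i hx
  have hp1 : 0 ≤ ∑ i, P1 i := Finset.sum_nonneg fun i _ => hP1 i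
  have hp2 : 0 ≤ ∑ i, ∑ j, P2 i j :=
    Finset.sum_nonneg fun i _ => Finset.sum_nonneg fun j _ => hP2 i j
  refine ⟨∑ i, P1 i + ∑ i, ∑ j, P2 i j + 1, φ, hs, fun x => φ.nonneg, fun x => φ.le_one,
    fun x hx => φ.one_of_mem_closedBall hx, h0, by positivity, fun x i => ?_, fun x i j => ?_⟩
  · have := Finset.single_le_sum (fun i _ => hP1 i) (Finset.mem_univ i)
    linarith [hP1' i x]
  · have h2 := Finset.single_le_sum (fun j _ => hP2 i j) (Finset.mem_univ j)
    have h3 := Finset.single_le_sum (f := fun i => ∑ j, P2 i j)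
      (fun i _ => Finset.sum_nonneg fun j _ => hP2 i j) (Finset.mem_univ i)
    linarith [hP2' i j x]

/-- The divergence of a compactly supported vector field integrates to zero. -/
theorem integral_div_eq_zero {n : ℕ} {F : Fin n → (Fin n → ℝ) → ℝ} {R : ℝ} (hR : R < 1)
    (hF : ∀ i, ContDiffOn ℝ 1 (F i) (ball 0 1)) (h0 : ∀ i, ∀ x ∉ closedBall 0 R, F i x = 0) :
    IntegrableOn (fun x => ∑ i, pd i (F i) x) (ball 0 1) ∧
      ∫ x in ball 0 1, ∑ i, pd i (F i) x = 0 := by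
  have hs : ∀ i, ContDiff ℝ 1 (F i) := fun i => contDiff_iff_contDiffAt.2 fun x => by
    by_cases hx : x ∈ ball (0 : Fin n → ℝ) 1
    · exact (hF i).contDiffAt (isOpen_ball.mem_nhds hx)
    · have hx' : x ∉ closedBall (0 : Fin n → ℝ) R := fun h => hx (closedBall_subset_ball hR h)
      exact contDiffAt_const.congr_of_eventuallyEq
        (Filter.eventuallyEq_of_mem (isClosed_closedBall.isOpen_compl.mem_nhds hx')
          fun y hy => h0 i y hy)
  have hc : ∀ i, HasCompactSupport (F i) := fun i =>
    HasCompactSupport.intro (isCompact_closedBall 0 R) (h0 i)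
  have hc' : ∀ i, HasCompactSupport (pd i (F i)) := fun i =>
    HasCompactSupport.intro (isCompact_closedBall 0 R) fun x hx => pd_eq_zero_of_notMem (h0 i) i hx
  have hi : ∀ i, Integrable (pd i (F i)) := fun i =>
    (contDiff_pd (l := 0) (hs i) (by norm_num) i).continuous.integrable_of_hasCompactSupport (hc' i)
  have hz : ∀ i, ∫ x, pd i (F i) x = 0 := fun i => by
    have := integral_mul_fderiv_eq_neg_fderiv_mul_of_integrable (μ := volume) (f := fun _ => (1 : ℝ))
      (g := F i) (v := Pi.single i (1 : ℝ)) (by simp) (by simpa using! hi i)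
      (by simpa using (hs i).continuous.integrable_of_hasCompactSupport (hc i))
      (by fun_prop) (fun x _ => (hs i).differentiable one_ne_zero x)
    simpa [pd] using! this
  refine ⟨(integrable_finsetSum _ fun i _ => hi i).integrableOn, ?_⟩
  rw [setIntegral_eq_integral_of_forall_compl_eq_zero, integral_finsetSum _ fun i _ => hi i]
  · simp [hz]
  · intro x hx
    have hx' : x ∉ closedBall (0 : Fin n → ℝ) R := fun h => hx (closedBall_subset_ball hR h)
    exact Finset.sum_eq_zero fun i _ => pd_eq_zero_of_notMem (h0 i) i hx'

end Cutoff

section Ramp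

open MeasureTheory

/-- A smooth convex nondecreasing ramp vanishing on the negative half-line. -/
noncomputable def ramp (t : ℝ) : ℝ := ∫ s in (0 : ℝ)..t, Real.smoothTransition s

theorem hasDerivAt_ramp (t : ℝ) : HasDerivAt ramp (Real.smoothTransition t) t :=
  intervalIntegral.integral_hasDerivAt_right (Real.smoothTransition.continuous.intervalIntegrable _ _)
    (Real.smoothTransition.continuous.stronglyMeasurableAtFilter _ _)
    Real.smoothTransition.continuous.continuousAt

theorem contDiff_ramp : ContDiff ℝ 1 ramp := by
  refine contDiff_one_iff_deriv.2 ⟨fun t => (hasDerivAt_ramp t).differentiableAt, ?_⟩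
  rw [funext fun t => (hasDerivAt_ramp t).deriv]
  exact Real.smoothTransition.continuous

theorem ramp_of_nonpos {t : ℝ} (ht : t ≤ 0) : ramp t = 0 := by
  rw [ramp, intervalIntegral.integral_congr (g := fun _ => 0)]
  · simp
  · intro s hs
    rw [uIcc_of_ge ht] at hs
    exact Real.smoothTransition.zero_of_nonpos hs.2

theorem ramp_nonneg (t : ℝ) : 0 ≤ ramp t := by
  rcases le_total t 0 with h | h
  · rw [ramp_of_nonpos h]
  · exact intervalIntegral.integral_nonneg h fun s _ => Real.smoothTransition.nonneg s

theorem ramp_le {t : ℝ} (ht : 0 ≤ t) : ramp t ≤ t := by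
  have h1 := intervalIntegral.integral_mono_on (μ := volume) ht
    (Real.smoothTransition.continuous.intervalIntegrable 0 t)
    (continuous_const.intervalIntegrable (u := fun _ => (1 : ℝ)) 0 t)
    fun s _ => Real.smoothTransition.le_one s
  simpa [ramp] using h1

theorem sub_one_le_ramp (t : ℝ) : t - 1 ≤ ramp t := by
  rcases le_total t 1 with h | h
  · linarith [ramp_nonneg t]
  · have h1 := intervalIntegral.integral_mono_on (μ := volume) h
      (continuous_const.intervalIntegrable (u := fun _ => (1 : ℝ)) 1 t)
      (Real.smoothTransition.continuous.intervalIntegrable 1 t)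
      fun s hs => (Real.smoothTransition.one_of_one_le hs.1).ge
    have h2 : ramp 1 + ∫ s in (1 : ℝ)..t, Real.smoothTransition s = ramp t :=
      intervalIntegral.integral_add_adjacent_intervals
        (Real.smoothTransition.continuous.intervalIntegrable _ _)
        (Real.smoothTransition.continuous.intervalIntegrable _ _)
    simp only [intervalIntegral.integral_const, smul_eq_mul, mul_one] at h1
    linarith [ramp_nonneg 1]

theorem deriv_smoothTransition_nonneg (t : ℝ) : 0 ≤ deriv Real.smoothTransition t :=
  Real.smoothTransition.monotone.deriv_nonneg

end Ramp

namespace IsSol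

open MeasureTheory

variable {n : ℕ} {K A M L b₀ : ℝ} {u h : (Fin n → ℝ) → ℝ} {x : Fin n → ℝ}

theorem hasPd_logLap_self (H : IsSol n K A M L u h) (hx : x ∈ ball 0 1) (i : Fin n) :
    HasPd i (logLap u) (pd i (logLap u) x) x :=
  (H.smooth_logLap.differentiableAt_of_isOpen isOpen_ball (by norm_num) hx).hasPd i

theorem hasPd_pd_logLap (H : IsSol n K A M L u h) (hx : x ∈ ball 0 1) (i j : Fin n) :
    HasPd i (pd j (logLap u)) (pd i (pd j (logLap u)) x) x :=
  ((H.smooth_logLap.pd (l := 1) isOpen_ball (by norm_num) j).differentiableAt_of_isOpen isOpen_ball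
    (by norm_num) hx).hasPd i

theorem hasPd_pd (H : IsSol n K A M L u h) (hx : x ∈ ball 0 1) (i j : Fin n) :
    HasPd i (pd j u) (pd i (pd j u) x) x :=
  ((H.smooth_pd j).differentiableAt_of_isOpen isOpen_ball (by norm_num) hx).hasPd i

theorem hasPd_ramp (H : IsSol n K A M L u h) (hx : x ∈ ball 0 1) (i : Fin n) :
    HasPd i (fun y => ramp (logLap u y - b₀))
      (Real.smoothTransition (logLap u x - b₀) * pd i (logLap u) x) x := by
  have h1 := HasPd.comp (hasDerivAt_ramp (logLap u x - b₀))
    ((H.hasPd_logLap_self hx i).sub (HasPd.const b₀))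
  rwa [sub_zero] at h1

theorem hasPd_smoothTransition (H : IsSol n K A M L u h) (hx : x ∈ ball 0 1) (i : Fin n) :
    HasPd i (fun y => Real.smoothTransition (logLap u y - b₀))
      (deriv Real.smoothTransition (logLap u x - b₀) * pd i (logLap u) x) x := by
  have h0 : DifferentiableAt ℝ Real.smoothTransition (logLap u x - b₀) :=
    (Real.smoothTransition.contDiff (n := 1)).differentiable one_ne_zero _
  have h1 := HasPd.comp h0.hasDerivAt ((H.hasPd_logLap_self hx i).sub (HasPd.const b₀))
  rwa [sub_zero] at h1

theorem div_ramp_grad (H : IsSol n K A M L u h) (hx : x ∈ ball 0 1) {φ : (Fin n → ℝ) → ℝ}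
    (hφ : Differentiable ℝ φ) :
    ∑ i, pd i (fun y => φ y * φ y * (ramp (logLap u y - b₀) * pd i u y)) x
      = φ x ^ 2 * ramp (logLap u x - b₀) * lap u x
        + φ x ^ 2 * Real.smoothTransition (logLap u x - b₀) * ∑ i, pd i (logLap u) x * pd i u x
        + 2 * φ x * ramp (logLap u x - b₀) * ∑ i, pd i φ x * pd i u x := by
  have h1 := fun i => ((((hφ x).hasPd i).mul ((hφ x).hasPd i)).mul
    ((H.hasPd_ramp (b₀ := b₀) hx i).mul (H.hasPd_pd hx i i))).2
  simp only [h1, lap, Finset.mul_sum, ← Finset.sum_add_distrib]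
  exact Finset.sum_congr rfl fun i _ => by ring

theorem div_cutoff_grad (H : IsSol n K A M L u h) (hx : x ∈ ball 0 1) {φ : (Fin n → ℝ) → ℝ}
    (hφ : Differentiable ℝ φ) :
    ∑ i, pd i (fun y => φ y * pd i u y) x = φ x * lap u x + ∑ i, pd i φ x * pd i u x := by
  have h1 := fun i => (((hφ x).hasPd i).mul (H.hasPd_pd hx i i)).2
  simp only [h1, lap, Finset.mul_sum, ← Finset.sum_add_distrib]
  exact Finset.sum_congr rfl fun i _ => by ring

theorem div_gmat_grad (H : IsSol n K A M L u h) (hx : x ∈ ball 0 1) {φ : (Fin n → ℝ) → ℝ}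
    (hφ : Differentiable ℝ φ) :
    ∑ i, pd i (fun y => φ y * φ y * (Real.smoothTransition (logLap u y - b₀)
        * ∑ j, gmat u h y i j * pd j (logLap u) y)) x
      = φ x ^ 2 * Real.smoothTransition (logLap u x - b₀)
          * (∑ i, ∑ j, gmat u h x i j * pd i (pd j (logLap u)) x)
        - φ x ^ 2 * Real.smoothTransition (logLap u x - b₀) * ∑ j, pd j (logLap u) x * pd j h x
        + φ x ^ 2 * deriv Real.smoothTransition (logLap u x - b₀)
          * ∑ i, ∑ j, gmat u h x i j * (pd i (logLap u) x * pd j (logLap u) x)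
        + 2 * φ x * Real.smoothTransition (logLap u x - b₀)
          * ∑ i, ∑ j, gmat u h x i j * (pd i φ x * pd j (logLap u) x) := by
  have hG : ∀ i j, HasPd i (fun y => gmat u h y i j) (pd i (fun y => gmat u h y i j) x) x :=
    fun i j => ⟨(H.hasPd_gmat hx i j i).1, rfl⟩
  have h1 := fun i => ((((hφ x).hasPd i).mul ((hφ x).hasPd i)).mul
    ((H.hasPd_smoothTransition (b₀ := b₀) hx i).mul
      (HasPd.sum (s := Finset.univ) fun j => (hG i j).mul (H.hasPd_pd_logLap hx i j)))).2
  have h2 : ∑ j, pd j (logLap u) x * pd j h x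
      = -∑ i, ∑ j, pd i (fun y => gmat u h y i j) x * pd j (logLap u) x := by
    rw [Finset.sum_comm, ← Finset.sum_neg_distrib]
    refine Finset.sum_congr rfl fun j _ => ?_
    rw [← Finset.sum_mul, H.div_gmat hx]; ring
  rw [h2]
  refine (Finset.sum_congr rfl fun i _ => h1 i).trans ?_
  simp only [Finset.mul_sum, mul_neg, sub_neg_eq_add]
  simp only [← Finset.sum_add_distrib]
  refine Finset.sum_congr rfl fun i _ => ?_
  simp only [mul_add, Finset.mul_sum, ← Finset.sum_add_distrib]
  exact Finset.sum_congr rfl fun j _ => by ring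

theorem abs_sum_logLap_le (H : IsSol n K A M L u h) (hx : x ∈ ball 0 1) {w : Fin n → ℝ} {m : ℝ}
    (hw : ∀ i, |w i| ≤ m) :
    |∑ i, pd i (logLap u) x * w i|
      ≤ 1 / 24 * (∑ i, ∑ j, gmat u h x i j * (pd i (logLap u) x * pd j (logLap u) x))
        + 12 * n * m ^ 2 * K ^ 2 * lap u x := by
  have h1 := H.norm_sq_le_gmat hx fun i => pd i (logLap u) x
  have h2 : ∑ i, w i ^ 2 ≤ n * m ^ 2 := by
    calc ∑ i, w i ^ 2 ≤ ∑ _i : Fin n, m ^ 2 := Finset.sum_le_sum fun i _ => by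
          rw [← sq_abs]; exact pow_le_pow_left₀ (abs_nonneg _) (hw i) 2
      _ = n * m ^ 2 := by simp
  have h3 := Finset.sum_mul_sq_le_sq_mul_sq Finset.univ (fun i => pd i (logLap u) x) w
  have hG := H.gmat_quad_nonneg hx fun i => pd i (logLap u) x
  have hl := H.lap_pos' hx
  set Q := ∑ i, ∑ j, gmat u h x i j * (pd i (logLap u) x * pd j (logLap u) x)
  refine abs_le_of_sq_le_sq (h3.trans ?_) (by positivity)
  calc (∑ i, pd i (logLap u) x ^ 2) * ∑ i, w i ^ 2
      ≤ (2 * K ^ 2 * lap u x * Q) * (n * m ^ 2) := by gcongr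
    _ ≤ _ := by nlinarith [sq_nonneg (1 / 24 * Q - 12 * n * m ^ 2 * K ^ 2 * lap u x)]

theorem abs_sum_mul_le {v w : Fin n → ℝ} {P m : ℝ} (hv : ∀ i, |v i| ≤ P)
    (hw : ∀ i, |w i| ≤ m) : |∑ i, v i * w i| ≤ n * P * m := by
  calc |∑ i, v i * w i| ≤ ∑ i, |v i * w i| := Finset.abs_sum_le_sum_abs _ _
    _ ≤ ∑ _i : Fin n, P * m := Finset.sum_le_sum fun i _ => by
        rw [abs_mul]
        exact mul_le_mul (hv i) (hw i) (abs_nonneg _) ((abs_nonneg _).trans (hv i))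
    _ = n * P * m := by simp [mul_assoc]

theorem ramp_le_lap (H : IsSol n K A M L u h) (hx : x ∈ ball 0 1) (hb : 0 ≤ b₀) :
    ramp (logLap u x - b₀) ≤ lap u x := by
  have hl := H.lap_pos' hx
  rcases le_total (logLap u x - b₀) 0 with h1 | h1
  · rw [ramp_of_nonpos h1]; exact hl.le
  · have := ramp_le h1
    have := Real.log_le_self hl.le
    rw [logLap] at *
    linarith

theorem energy_algebra {a X s f t t' Q B Gpb Gpp S1 S2 S3 S4 c₁ c₂ c₃ g p q : ℝ} (ha0 : 0 ≤ a)
    (ha1 : a ≤ 1) (hX : 0 ≤ X) (hs : 0 ≤ s) (hf0 : 0 ≤ f) (hfs : f ≤ s) (ht0 : 0 ≤ t) (ht1 : t ≤ 1)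
    (ht' : 0 ≤ t') (hQ : 0 ≤ Q) (haX : a ≤ X) (hc₁ : 0 ≤ c₁) (hc₂ : 0 ≤ c₂) (hc₃ : 0 ≤ c₃)
    (hg : 0 ≤ g) (hp : 0 ≤ p) (e1 : -(1 / 24 * Q + c₃ * s) ≤ S3) (e2 : S4 ≤ 1 / 24 * Q + c₂ * s)
    (e3 : -p ≤ S1) (e4 : -q ≤ S2)
    (e5 : -(2 * (24 * a * Gpb)) ≤ 576 * Gpp + a ^ 2 * Q) (e6 : Gpp ≤ g * (X * s))
    (e8 : t * (1 / 6 * Q - c₁ * s) ≤ t * B) :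
    2 * (X * s) + a ^ 2 * f * s ≤ a ^ 2 * f * s + a ^ 2 * t * S3 + 2 * a * f * S1
      + 12 * (a ^ 2 * t * B - a ^ 2 * t * S4 + a ^ 2 * t' * Q + 2 * a * t * Gpb)
      + (12 * (c₁ + c₂ + 24 * g) + c₃ + 2 * p + 2) * (X * s + S2 + q) := by
  have hcs : ∀ d : ℝ, 0 ≤ d → a ^ 2 * t * (d * s) ≤ d * (X * s) := fun d hd => by
    have h1 : a ^ 2 ≤ a := by nlinarith
    have : a ^ 2 * t ≤ X := (mul_le_of_le_one_right (sq_nonneg a) ht1).trans (h1.trans haX)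
    calc a ^ 2 * t * (d * s) ≤ X * (d * s) := by gcongr
      _ = _ := by ring
  have k1 := hcs c₁ hc₁
  have k2 := hcs c₂ hc₂
  have k3 := hcs c₃ hc₃
  have hat : 0 ≤ a ^ 2 * t := by positivity
  have m1 := mul_le_mul_of_nonneg_left e8 (sq_nonneg a)
  have m2 := mul_le_mul_of_nonneg_left e2 hat
  have m3 := mul_le_mul_of_nonneg_left e1 hat
  have m4 : -(2 * p * (X * s)) ≤ 2 * a * f * S1 := by
    have h1 := mul_le_mul_of_nonneg_left e3 (by positivity : 0 ≤ 2 * a * f)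
    have h2 : a * f ≤ X * s := by gcongr
    have h3 := mul_le_mul_of_nonneg_left h2 (by positivity : 0 ≤ 2 * p)
    linarith
  have m5 := mul_le_mul_of_nonneg_left e5 ht0
  have m6 : t * Gpp ≤ g * (X * s) := by
    have h0 : 0 ≤ g * (X * s) := by positivity
    calc t * Gpp ≤ t * (g * (X * s)) := by gcongr
      _ ≤ _ := mul_le_of_le_one_left h0 ht1
  have m7 : 0 ≤ a ^ 2 * t' * Q := by positivity
  have m8 : 0 ≤ a ^ 2 * t * Q := by positivity
  have m9 : (12 * (c₁ + c₂ + 24 * g) + c₃ + 2 * p + 2) * (X * s)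
      ≤ (12 * (c₁ + c₂ + 24 * g) + c₃ + 2 * p + 2) * (X * s + S2 + q) := by
    gcongr
    linarith
  linarith

/-- The pointwise inequality behind the energy estimate. -/
theorem energy_pointwise (H : IsSol n K A M L u h) (hx : x ∈ ball 0 1) (hb : 0 ≤ b₀)
    (hthr : threshold n K A ≤ Real.exp b₀) {φ χ : (Fin n → ℝ) → ℝ} {P P' : ℝ}
    (hφ : Cutoff n (1 / 2) (3 / 4) P φ) (hχ : Cutoff n (3 / 4) (7 / 8) P' χ) {c : ℝ}
    (hc : c = 12 * (4 * n * L ^ 2 * K ^ 2 + n * L * (K + 1) + 12 * n * L ^ 2 * K ^ 2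
      + 24 * ((1 + A * K / 2) * (n * P ^ 2))) + 12 * n * M ^ 2 * K ^ 2 + 2 * (n * P * M)) :
    2 * (χ x * lap u x) + φ x ^ 2 * ramp (logLap u x - b₀) * lap u x
      ≤ ∑ i, pd i (fun y => φ y * φ y * (ramp (logLap u y - b₀) * pd i u y)) x
        + 12 * ∑ i, pd i (fun y => φ y * φ y * (Real.smoothTransition (logLap u y - b₀)
        * ∑ j, gmat u h y i j * pd j (logLap u) y)) x
        + (c + 2) * (∑ i, pd i (fun y => χ y * pd i u y) x + n * P' * M) := by
  have hl := H.lap_pos' hx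
  have hK := H.hK
  have hL := H.hL
  have hM := H.hM
  have hA := H.hA
  have hP := hφ.P_pos
  rw [H.div_ramp_grad hx (hφ.smooth.differentiable (by norm_num)),
    H.div_gmat_grad hx (hφ.smooth.differentiable (by norm_num)),
    H.div_cutoff_grad hx (hχ.smooth.differentiable (by norm_num))]
  have e1 := abs_le.1 (H.abs_sum_logLap_le hx (H.du_le x hx))
  have e2 := abs_le.1 (H.abs_sum_logLap_le hx (H.dh_le x hx))
  have e3 := abs_le.1 (abs_sum_mul_le (hφ.pd_le x) (H.du_le x hx))
  have e4 := abs_le.1 (abs_sum_mul_le (hχ.pd_le x) (H.du_le x hx))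
  have e5 := H.two_mul_gmat_le hx (fun i => 24 * pd i φ x) (fun i => φ x * pd i (logLap u) x)
  have e5a : ∑ i, ∑ j, gmat u h x i j * (24 * pd i φ x * (φ x * pd j (logLap u) x))
      = 24 * φ x * ∑ i, ∑ j, gmat u h x i j * (pd i φ x * pd j (logLap u) x) := by
    simp only [Finset.mul_sum]
    exact Finset.sum_congr rfl fun i _ => Finset.sum_congr rfl fun j _ => by ring
  have e5b : ∑ i, ∑ j, gmat u h x i j * (24 * pd i φ x * (24 * pd j φ x))
      = 576 * ∑ i, ∑ j, gmat u h x i j * (pd i φ x * pd j φ x) := by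
    simp only [Finset.mul_sum]
    exact Finset.sum_congr rfl fun i _ => Finset.sum_congr rfl fun j _ => by ring
  have e5c : ∑ i, ∑ j, gmat u h x i j * (φ x * pd i (logLap u) x * (φ x * pd j (logLap u) x))
      = φ x ^ 2 * ∑ i, ∑ j, gmat u h x i j * (pd i (logLap u) x * pd j (logLap u) x) := by
    simp only [Finset.mul_sum]
    exact Finset.sum_congr rfl fun i _ => Finset.sum_congr rfl fun j _ => by ring
  rw [e5a, e5b, e5c] at e5
  have e6 : ∑ i, ∑ j, gmat u h x i j * (pd i φ x * pd j φ x)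
      ≤ (1 + A * K / 2) * (n * P ^ 2) * (χ x * lap u x) := by
    by_cases hx' : x ∈ closedBall (0 : Fin n → ℝ) (3 / 4)
    · refine (H.gmat_quad_le hx _).trans ?_
      have h1 : ∑ i, pd i φ x ^ 2 ≤ n * P ^ 2 := by
        calc ∑ i, pd i φ x ^ 2 ≤ ∑ _i : Fin n, P ^ 2 := Finset.sum_le_sum fun i _ => by
              rw [← sq_abs]; exact pow_le_pow_left₀ (abs_nonneg _) (hφ.pd_le x i) 2
          _ = n * P ^ 2 := by simp
      have h2 : lap u x + A ≤ (1 + A * K / 2) * lap u x := by nlinarith [H.two_le_lap hx]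
      rw [hχ.eq_one x hx']
      calc (lap u x + A) * ∑ i, pd i φ x ^ 2 ≤ ((1 + A * K / 2) * lap u x) * (n * P ^ 2) := by
            gcongr
        _ = _ := by ring
    · simp only [pd_eq_zero_of_notMem hφ.eq_zero _ hx', mul_zero, Finset.sum_const_zero]
      have := hχ.nonneg x
      positivity
  have e7 : φ x ≤ χ x := by
    by_cases hx' : x ∈ closedBall (0 : Fin n → ℝ) (3 / 4)
    · rw [hχ.eq_one x hx']; exact hφ.le_one x
    · rw [hφ.eq_zero x hx']; exact hχ.nonneg x
  have e8 : Real.smoothTransition (logLap u x - b₀) * (1 / 6 * (∑ i, ∑ j,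
      gmat u h x i j * (pd i (logLap u) x * pd j (logLap u) x))
        - (4 * n * L ^ 2 * K ^ 2 + n * L * (K + 1)) * lap u x)
      ≤ Real.smoothTransition (logLap u x - b₀)
        * ∑ i, ∑ j, gmat u h x i j * pd i (pd j (logLap u)) x := by
    rcases le_total (logLap u x - b₀) 0 with h1 | h1
    · simp [Real.smoothTransition.zero_of_nonpos h1]
    · refine mul_le_mul_of_nonneg_left (H.jacobi hx (hthr.trans ?_))
        (Real.smoothTransition.nonneg _)
      rw [← Real.exp_log hl]
      exact Real.exp_le_exp.2 (sub_nonneg.1 h1)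
  have hG := H.gmat_quad_nonneg hx fun i => pd i (logLap u) x
  have hf0 := ramp_nonneg (logLap u x - b₀)
  have hfs := H.ramp_le_lap hx hb
  have ht0 := Real.smoothTransition.nonneg (logLap u x - b₀)
  have ht1 := Real.smoothTransition.le_one (logLap u x - b₀)
  have ht' := deriv_smoothTransition_nonneg (logLap u x - b₀)
  have ha0 := hφ.nonneg x
  have ha1 := hφ.le_one x
  have hχ0 := hχ.nonneg x
  rw [hc]
  exact energy_algebra ha0 ha1 hχ0 hl.le hf0 hfs ht0 ht1 ht' hG e7 (by positivity) (by positivity)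
    (by positivity) (by positivity) (by positivity) e1.1 e2.2 e3.1 e4.1 e5 e6 e8

theorem exists_energy_bound (n : ℕ) {K A M L b₀ : ℝ} (hb : 0 ≤ b₀)
    (hthr : threshold n K A ≤ Real.exp b₀) :
    ∃ C : ℝ, ∀ u h : (Fin n → ℝ) → ℝ, IsSol n K A M L u h →
      IntegrableOn (fun x => lap u x * (2 + ramp (logLap u x - b₀))) (closedBall 0 (1 / 2)) ∧
      ∫ x in closedBall 0 (1 / 2), lap u x * (2 + ramp (logLap u x - b₀)) ≤ C := by
  obtain ⟨P, φ, hφ⟩ := exists_cutoff n (r := 1 / 2) (R := 3 / 4) (by norm_num) (by norm_num)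
  obtain ⟨P', χ, hχ⟩ := exists_cutoff n (r := 3 / 4) (R := 7 / 8) (by norm_num) (by norm_num)
  refine ⟨((12 * (4 * n * L ^ 2 * K ^ 2 + n * L * (K + 1) + 12 * n * L ^ 2 * K ^ 2
      + 24 * ((1 + A * K / 2) * (n * P ^ 2))) + 12 * n * M ^ 2 * K ^ 2 + 2 * (n * P * M)) + 2)
      * (n * P' * M) * volume.real (ball (0 : Fin n → ℝ) 1), fun u h H => ?_⟩
  set c := 12 * (4 * n * L ^ 2 * K ^ 2 + n * L * (K + 1) + 12 * n * L ^ 2 * K ^ 2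
      + 24 * ((1 + A * K / 2) * (n * P ^ 2))) + 12 * n * M ^ 2 * K ^ 2 + 2 * (n * P * M) with hc
  have hsub : closedBall (0 : Fin n → ℝ) (1 / 2) ⊆ ball 0 1 := closedBall_subset_ball (by norm_num)
  have hpt := fun x hx => H.energy_pointwise (x := x) hx hb hthr hφ hχ hc
  have sφ : ContDiffOn ℝ 1 φ (ball 0 1) := (hφ.smooth.of_le (by norm_num)).contDiffOn
  have sχ : ContDiffOn ℝ 1 χ (ball 0 1) := (hχ.smooth.of_le (by norm_num)).contDiffOn
  have su : ∀ i, ContDiffOn ℝ 1 (pd i u) (ball 0 1) := fun i => (H.smooth_pd i).of_le (by norm_num)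
  have sb : ContDiffOn ℝ 1 (fun x => logLap u x - b₀) (ball 0 1) :=
    (H.smooth_logLap.of_le (by norm_num)).sub contDiffOn_const
  have sG : ∀ i j, ContDiffOn ℝ 1 (fun x => gmat u h x i j) (ball 0 1) := fun i j =>
    ((contDiffOn_const.mul ((H.smooth_lap.sub H.h_smooth))).sub (H.smooth_pd_pd i j)).of_le
      (by norm_num)
  have sb' : ∀ j, ContDiffOn ℝ 1 (pd j (logLap u)) (ball 0 1) := fun j =>
    H.smooth_logLap.pd isOpen_ball (by norm_num) j
  obtain ⟨i1, z1⟩ := integral_div_eq_zero (n := n) (R := 3 / 4)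
    (F := fun i y => φ y * φ y * (ramp (logLap u y - b₀) * pd i u y)) (by norm_num)
    (fun i => (sφ.mul sφ).mul ((contDiff_ramp.comp_contDiffOn sb).mul (su i)))
    (fun i x hx => by simp [hφ.eq_zero x hx])
  obtain ⟨i2, z2⟩ := integral_div_eq_zero (n := n) (R := 3 / 4)
    (F := fun i y => φ y * φ y * (Real.smoothTransition (logLap u y - b₀)
        * ∑ j, gmat u h y i j * pd j (logLap u) y)) (by norm_num)
    (fun i => (sφ.mul sφ).mul ((Real.smoothTransition.contDiff.comp_contDiffOn sb).mul
      (ContDiffOn.sum fun j _ => (sG i j).mul (sb' j))))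
    (fun i x hx => by simp [hφ.eq_zero x hx])
  obtain ⟨i3, z3⟩ := integral_div_eq_zero (n := n) (R := 7 / 8)
    (F := fun i y => χ y * pd i u y) (by norm_num)
    (fun i => sχ.mul (su i)) (fun i x hx => by simp [hχ.eq_zero x hx])
  have hconst : IntegrableOn (fun _ => (n : ℝ) * P' * M) (ball (0 : Fin n → ℝ) 1) :=
    integrableOn_const (measure_ball_lt_top.ne)
  have hsum := (i1.add (i2.const_mul 12)).add ((i3.add hconst).const_mul (c + 2))
  have hgInt : IntegrableOn (fun x => lap u x * (2 + ramp (logLap u x - b₀)))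
      (closedBall 0 (1 / 2)) := by
    refine ContinuousOn.integrableOn_compact (isCompact_closedBall 0 _) ?_
    refine ContinuousOn.mono ?_ hsub
    exact H.smooth_lap.continuousOn.mul (continuousOn_const.add
      (contDiff_ramp.continuous.comp_continuousOn sb.continuousOn))
  refine ⟨hgInt, ?_⟩
  calc ∫ x in closedBall 0 (1 / 2), lap u x * (2 + ramp (logLap u x - b₀))
      ≤ ∫ x in closedBall (0 : Fin n → ℝ) (1 / 2), _ := by
        refine setIntegral_mono_on hgInt (hsum.mono_set hsub) measurableSet_closedBall fun x hx => ?_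
        have := hpt x (hsub hx)
        have h34 : x ∈ closedBall (0 : Fin n → ℝ) (3 / 4) :=
          closedBall_subset_closedBall (by norm_num) hx
        rw [hφ.eq_one x hx, hχ.eq_one x h34] at this
        refine le_trans (le_of_eq ?_) this
        ring
    _ ≤ ∫ x in ball (0 : Fin n → ℝ) 1, _ := by
        refine setIntegral_mono_set hsum ?_ (Filter.Eventually.of_forall fun x => @hsub x)
        refine (ae_restrict_iff' measurableSet_ball).2 (Filter.Eventually.of_forall fun x hx => ?_)
        refine le_trans ?_ (hpt x hx)
        have := hχ.nonneg x
        have := (H.lap_pos' hx).le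
        have := ramp_nonneg (logLap u x - b₀)
        positivity
    _ = _ := by
        have e := integral_add (i1.add (i2.const_mul 12)) ((i3.add hconst).const_mul (c + 2))
        refine e.trans ?_
        have e2 := integral_add i1 (i2.const_mul 12)
        have e3 := integral_add i3 hconst
        simp only [Pi.add_apply] at e2 e3 ⊢
        rw [e2, integral_const_mul, integral_const_mul, e3, z1, z2, z3]
        simp [Measure.real]
        ring

end IsSol

/-- The truncated auxiliary function of the Alexandrov-Bakelman-Pucci argument. -/
noncomputable def abpFun {n : ℕ} (m : ℕ) (b₀ : ℝ) (ζ u : (Fin n → ℝ) → ℝ) (x : Fin n → ℝ) : ℝ :=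
  ζ x ^ (m + 2) * (logLap u x - b₀)

/-- The constant in the bound for the linearized operator applied to `abpFun`. -/
noncomputable def abpConst (n m : ℕ) (K A L P : ℝ) : ℝ :=
  (m + 2) * (n * n * P * (2 + K ^ 2 / 2)) + 6 * (m + 2) ^ 2 * ((1 + A * K / 2) * (n * P ^ 2))
    + (4 * n * L ^ 2 * K ^ 2 + n * L * (K + 1))

namespace IsSol

variable {n : ℕ} {K A M L b₀ : ℝ} {u h ζ : (Fin n → ℝ) → ℝ} {x : Fin n → ℝ} {m : ℕ}

theorem smooth_abpFun (H : IsSol n K A M L u h) (hζ : ContDiff ℝ 3 ζ) :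
    ContDiffOn ℝ 2 (abpFun m b₀ ζ u) (ball 0 1) :=
  ((hζ.of_le (by norm_num)).contDiffOn.pow _).mul (H.smooth_logLap.sub contDiffOn_const)

theorem hasPd_abpFun (H : IsSol n K A M L u h) (hζ : ContDiff ℝ 3 ζ) (hx : x ∈ ball 0 1)
    (j : Fin n) : HasPd j (abpFun m b₀ ζ u)
      ((m + 2) * ζ x ^ (m + 1) * pd j ζ x * (logLap u x - b₀)
        + ζ x ^ (m + 2) * pd j (logLap u) x) x := by
  have h1 := HasPd.comp (hasDerivAt_pow (m + 2) (ζ x)) ((hζ.differentiable (by norm_num) x).hasPd j)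
  have h2 := h1.mul ((H.hasPd_logLap_self hx j).sub (HasPd.const b₀))
  refine ⟨h2.1, h2.2.trans ?_⟩
  push_cast
  simp

theorem pd_pd_abpFun (H : IsSol n K A M L u h) (hζ : ContDiff ℝ 3 ζ) (hx : x ∈ ball 0 1)
    (i j : Fin n) : pd i (pd j (abpFun m b₀ ζ u)) x
      = ζ x ^ m * ((m + 2) * (logLap u x - b₀) * ((m + 1) * (pd i ζ x * pd j ζ x)
          + ζ x * pd i (pd j ζ) x)
        + (m + 2) * ζ x * (pd i ζ x * pd j (logLap u) x + pd j ζ x * pd i (logLap u) x)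
        + ζ x ^ 2 * pd i (pd j (logLap u)) x) := by
  have h0 := ((hζ.differentiable (by norm_num) x).hasPd i)
  have h1 := HasPd.comp (hasDerivAt_pow (m + 1) (ζ x)) h0
  have h2 := HasPd.comp (hasDerivAt_pow (m + 2) (ζ x)) h0
  have h3 := ((contDiff_pd (l := 2) hζ (by norm_num) j).differentiable (by norm_num) x).hasPd i
  have h4 := (((h1.const_mul (m + 2 : ℝ)).mul h3).mul
    ((H.hasPd_logLap_self hx i).sub (HasPd.const b₀))).add (h2.mul (H.hasPd_pd_logLap hx i j))
  rw [pd_congr isOpen_ball hx fun y hy => (H.hasPd_abpFun hζ hy j).2, h4.2]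
  push_cast
  ring

theorem abs_gmat_le (H : IsSol n K A M L u h) (hx : x ∈ ball 0 1) (i j : Fin n) :
    |gmat u h x i j| ≤ (2 + K ^ 2 / 2) * lap u x := by
  have hl := H.lap_pos' hx
  have hK := H.hK
  have h0 : 0 ≤ h x := (inv_pos.2 hK).le.trans (H.h_lower x hx)
  have h1 := H.h_upper x hx
  have h2 := H.abs_hess_le hx i j
  have h3 : |(1 : Matrix (Fin n) (Fin n) ℝ) i j * (lap u x - h x)| ≤ lap u x + K := by
    rw [Matrix.one_apply]
    split_ifs
    · rw [one_mul, abs_le]; constructor <;> linarith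
    · simp; positivity
  have h4 := H.two_le_lap hx
  have h5 := abs_sub ((1 : Matrix (Fin n) (Fin n) ℝ) i j * (lap u x - h x)) (pd i (pd j u) x)
  rw [gmat]
  nlinarith

theorem gmat_abpFun (H : IsSol n K A M L u h) (hζ : ContDiff ℝ 3 ζ) (hx : x ∈ ball 0 1) :
    ∑ i, ∑ j, gmat u h x i j * pd i (pd j (abpFun m b₀ ζ u)) x
      = ζ x ^ m * ((m + 2) * (logLap u x - b₀) * ((m + 1)
          * (∑ i, ∑ j, gmat u h x i j * (pd i ζ x * pd j ζ x))
          + ζ x * ∑ i, ∑ j, gmat u h x i j * pd i (pd j ζ) x)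
        + 2 * (m + 2) * ζ x * (∑ i, ∑ j, gmat u h x i j * (pd i ζ x * pd j (logLap u) x))
        + ζ x ^ 2 * ∑ i, ∑ j, gmat u h x i j * pd i (pd j (logLap u)) x) := by
  have h1 : ∑ i, ∑ j, gmat u h x i j * (pd j ζ x * pd i (logLap u) x)
      = ∑ i, ∑ j, gmat u h x i j * (pd i ζ x * pd j (logLap u) x) := by
    rw [Finset.sum_comm]
    exact Finset.sum_congr rfl fun i _ => Finset.sum_congr rfl fun j _ => by
      rw [H.gmat_symm hx]
  have h2 : 2 * (m + 2) * ζ x * (∑ i, ∑ j, gmat u h x i j * (pd i ζ x * pd j (logLap u) x))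
      = (m + 2) * ζ x * (∑ i, ∑ j, gmat u h x i j * (pd i ζ x * pd j (logLap u) x)
        + ∑ i, ∑ j, gmat u h x i j * (pd j ζ x * pd i (logLap u) x)) := by rw [h1]; ring
  rw [h2]
  simp only [Finset.mul_sum, ← Finset.sum_add_distrib, H.pd_pd_abpFun hζ hx]
  exact Finset.sum_congr rfl fun i _ => Finset.sum_congr rfl fun j _ => by ring

/-- The linearized operator applied to the auxiliary function. -/
theorem neg_gmat_abpFun_le (H : IsSol n K A M L u h) {r R P : ℝ} (hζ : Cutoff n r R P ζ)
    (hx : x ∈ ball 0 1) (hthr : threshold n K A ≤ Real.exp b₀) (hv : b₀ ≤ logLap u x) :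
    -(∑ i, ∑ j, gmat u h x i j * pd i (pd j (abpFun m b₀ ζ u)) x)
      ≤ abpConst n m K A L P * lap u x * (ζ x ^ m * (1 + (logLap u x - b₀))) := by
  have hl := H.lap_pos' hx
  have hK := H.hK
  have hL := H.hL
  have hA := H.hA
  have hP := hζ.P_pos
  have e8 := H.jacobi hx (hthr.trans (by
    rw [← Real.exp_log hl]; exact Real.exp_le_exp.2 hv))
  have e6 : ∑ i, ∑ j, gmat u h x i j * (pd i ζ x * pd j ζ x)
      ≤ (1 + A * K / 2) * (n * P ^ 2) * lap u x := by
    refine (H.gmat_quad_le hx _).trans ?_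
    have h1 : ∑ i, pd i ζ x ^ 2 ≤ n * P ^ 2 := by
      calc ∑ i, pd i ζ x ^ 2 ≤ ∑ _i : Fin n, P ^ 2 := Finset.sum_le_sum fun i _ => by
            rw [← sq_abs]; exact pow_le_pow_left₀ (abs_nonneg _) (hζ.pd_le x i) 2
        _ = n * P ^ 2 := by simp
    have h2 : lap u x + A ≤ (1 + A * K / 2) * lap u x := by nlinarith [H.two_le_lap hx]
    calc (lap u x + A) * ∑ i, pd i ζ x ^ 2 ≤ ((1 + A * K / 2) * lap u x) * (n * P ^ 2) := by
          gcongr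
      _ = _ := by ring
  have e5 := H.two_mul_gmat_le hx (fun i => 6 * (m + 2) * pd i ζ x)
    (fun i => ζ x * pd i (logLap u) x)
  have e5a : ∑ i, ∑ j, gmat u h x i j * (6 * (m + 2) * pd i ζ x * (ζ x * pd j (logLap u) x))
      = 6 * (m + 2) * ζ x * ∑ i, ∑ j, gmat u h x i j * (pd i ζ x * pd j (logLap u) x) := by
    simp only [Finset.mul_sum]
    exact Finset.sum_congr rfl fun i _ => Finset.sum_congr rfl fun j _ => by ring
  have e5b : ∑ i, ∑ j, gmat u h x i j * (6 * (m + 2) * pd i ζ x * (6 * (m + 2) * pd j ζ x))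
      = 36 * (m + 2) ^ 2 * ∑ i, ∑ j, gmat u h x i j * (pd i ζ x * pd j ζ x) := by
    simp only [Finset.mul_sum]
    exact Finset.sum_congr rfl fun i _ => Finset.sum_congr rfl fun j _ => by ring
  have e5c : ∑ i, ∑ j, gmat u h x i j * (ζ x * pd i (logLap u) x * (ζ x * pd j (logLap u) x))
      = ζ x ^ 2 * ∑ i, ∑ j, gmat u h x i j * (pd i (logLap u) x * pd j (logLap u) x) := by
    simp only [Finset.mul_sum]
    exact Finset.sum_congr rfl fun i _ => Finset.sum_congr rfl fun j _ => by ring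
  rw [e5a, e5b, e5c] at e5
  have e7 : |∑ i, ∑ j, gmat u h x i j * pd i (pd j ζ) x|
      ≤ n * n * P * (2 + K ^ 2 / 2) * lap u x := by
    calc |∑ i, ∑ j, gmat u h x i j * pd i (pd j ζ) x|
        ≤ ∑ i : Fin n, ∑ j : Fin n, (2 + K ^ 2 / 2) * lap u x * P := by
          refine (Finset.abs_sum_le_sum_abs _ _).trans (Finset.sum_le_sum fun i _ =>
            (Finset.abs_sum_le_sum_abs _ _).trans (Finset.sum_le_sum fun j _ => ?_))
          rw [abs_mul]
          exact mul_le_mul (H.abs_gmat_le hx i j) (hζ.pd_pd_le x i j) (abs_nonneg _) (by positivity)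
      _ = _ := by simp; ring
  have hG := H.gmat_quad_nonneg hx fun i => pd i ζ x
  have hz0 := hζ.nonneg x
  have hz1 := hζ.le_one x
  rw [H.gmat_abpFun hζ.smooth hx, abpConst]
  have hc₁ : 0 ≤ 4 * n * L ^ 2 * K ^ 2 + n * L * (K + 1) := by positivity
  have hg : 0 ≤ (1 + A * K / 2) * (n * P ^ 2) := by positivity
  have hq : 0 ≤ n * n * P * (2 + K ^ 2 / 2) := by positivity
  have hv0 := sub_nonneg.2 hv
  have e9 := (abs_le.1 e7).1
  generalize (∑ i, ∑ j, gmat u h x i j * (pd i (logLap u) x * pd j (logLap u) x)) = Q at *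
  generalize (∑ i, ∑ j, gmat u h x i j * pd i (pd j (logLap u)) x) = B at *
  generalize (∑ i, ∑ j, gmat u h x i j * (pd i ζ x * pd j (logLap u) x)) = Gpb at *
  generalize (∑ i, ∑ j, gmat u h x i j * (pd i ζ x * pd j ζ x)) = Gpp at *
  generalize (∑ i, ∑ j, gmat u h x i j * pd i (pd j ζ) x) = D at *
  generalize 4 * n * L ^ 2 * K ^ 2 + n * L * (K + 1) = c₁ at *
  generalize (1 + A * K / 2) * (n * P ^ 2) = g at *
  generalize n * n * P * (2 + K ^ 2 / 2) = q at *
  generalize logLap u x - b₀ = v at *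
  generalize lap u x = s at *
  have hzm : 0 ≤ ζ x ^ m := by positivity
  generalize ζ x ^ m = Zm at *
  generalize ζ x = z at *
  have hm : (0 : ℝ) ≤ m := Nat.cast_nonneg m
  generalize (m : ℝ) = m at *
  have key : -((m + 2) * v * ((m + 1) * Gpp + z * D) + 2 * (m + 2) * z * Gpb + z ^ 2 * B)
      ≤ ((m + 2) * q + 6 * (m + 2) ^ 2 * g + c₁) * s * (1 + v) := by
    have k1 : -(z * D) ≤ q * s := by
      have h1 := mul_le_mul_of_nonneg_left e9 hz0
      have h2 : z * (q * s) ≤ q * s := mul_le_of_le_one_left (by positivity) hz1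
      linarith
    have k2 := mul_le_mul_of_nonneg_left k1 (by positivity : 0 ≤ (m + 2) * v)
    have k3 : 0 ≤ (m + 2) * v * ((m + 1) * Gpp) := by positivity
    have k4 := mul_le_mul_of_nonneg_left e8 (sq_nonneg z)
    have k5 : z ^ 2 * (c₁ * s) ≤ c₁ * s :=
      mul_le_of_le_one_left (by positivity) (pow_le_one₀ hz0 hz1)
    have k6 := mul_le_mul_of_nonneg_left e6 (by positivity : 0 ≤ 6 * (m + 2) ^ 2)
    have k7 : 0 ≤ (m + 2) * q * s := by positivity
    have k8 : 0 ≤ (6 * (m + 2) ^ 2 * g + c₁) * s * v := by positivity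
    linarith
  have := mul_le_mul_of_nonneg_left key hzm
  linarith

end IsSol

section MaximumPrinciple

variable {n : ℕ} {F : (Fin n → ℝ) → ℝ} {x : Fin n → ℝ}

theorem fderiv_fderiv_eq_sum (hF : ContDiffAt ℝ 2 F x) (v : Fin n → ℝ) :
    fderiv ℝ (fderiv ℝ F) x v v = ∑ i, ∑ j, v i * pd i (pd j F) x * v j := by
  have hv : v = ∑ i, v i • Pi.single i (1 : ℝ) := by
    ext j
    simp [Finset.sum_apply, Pi.single_apply]
  simp only [pd_pd_eq hF]
  conv_lhs => rw [hv]
  simp only [map_sum, map_smul, _root_.sum_apply, _root_.smul_apply, smul_eq_mul, Finset.mul_sum]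
  rw [Finset.sum_comm]
  exact Finset.sum_congr rfl fun i _ => Finset.sum_congr rfl fun j _ => by ring

theorem second_derivative_nonpos (hF : ContDiffAt ℝ 2 F x) (hm : IsLocalMax F x)
    (v : Fin n → ℝ) : fderiv ℝ (fderiv ℝ F) x v v ≤ 0 := by
  by_contra! hpos
  have hl : ∀ t : ℝ, HasDerivAt (fun t : ℝ => x + t • v) v t := fun t => by
    simpa using ((hasDerivAt_id t).smul_const v).const_add x
  have hl0 : Filter.Tendsto (fun t : ℝ => x + t • v) (nhds 0) (nhds x) := by
    have := (hl 0).continuousAt.tendsto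
    simpa using this
  have hd : deriv (fun t : ℝ => F (x + t • v)) =ᶠ[nhds 0] fun t => fderiv ℝ F (x + t • v) v := by
    have h1 : ∀ᶠ y in nhds x, DifferentiableAt ℝ F y :=
      (hF.eventually (by simp)).mono fun y hy => hy.differentiableAt (by norm_num)
    filter_upwards [hl0.eventually h1] with t ht
    have h2 : HasDerivAt (fun t : ℝ => F (x + t • v)) (fderiv ℝ F (x + t • v) v) t :=
      ht.hasFDerivAt.comp_hasDerivAt t (hl t)
    exact h2.deriv
  have hdd : deriv (deriv fun t : ℝ => F (x + t • v)) 0 = fderiv ℝ (fderiv ℝ F) x v v := by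
    rw [hd.deriv_eq]
    have h2 : DifferentiableAt ℝ (fderiv ℝ F) (x + (0 : ℝ) • v) := by
      rw [zero_smul, add_zero]
      exact (hF.fderiv_right (m := 1) (by norm_num)).differentiableAt one_ne_zero
    have h3 : HasDerivAt (fun t : ℝ => fderiv ℝ F (x + t • v))
        (fderiv ℝ (fderiv ℝ F) (x + (0 : ℝ) • v) v) 0 :=
      h2.hasFDerivAt.comp_hasDerivAt (0 : ℝ) (hl 0)
    rw [(h3.clm_apply (hasDerivAt_const (0 : ℝ) v)).deriv]
    simp
  have hmax : IsLocalMax (fun t : ℝ => F (x + t • v)) 0 := by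
    have := hl0.eventually hm
    simpa [IsLocalMax, IsMaxFilter] using this
  have hmin := isLocalMin_of_deriv_deriv_pos (f := fun t : ℝ => F (x + t • v)) (x₀ := 0)
    (by rw [hdd]; exact hpos) hmax.deriv_eq_zero (by
      have h4 : ContinuousAt F (x + (0 : ℝ) • v) := by simpa using hF.continuousAt
      exact ContinuousAt.comp (f := fun t : ℝ => x + t • v) h4 (hl 0).continuousAt)
  have hconst : (fun t : ℝ => F (x + t • v)) =ᶠ[nhds 0] fun _ => F (x + (0 : ℝ) • v) := by
    filter_upwards [hmax, hmin] with t h1 h2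
    exact le_antisymm h1 h2
  have := hconst.deriv.deriv_eq
  rw [hdd] at this
  simp at this
  linarith

end MaximumPrinciple

section MatrixMaps

open Matrix

variable {n : ℕ} {U : Set (Fin n → ℝ)} {J : (Fin n → ℝ) → Matrix (Fin n) (Fin n) ℝ}
  {g : Fin n → (Fin n → ℝ) → ℝ} {x : Fin n → ℝ}

theorem contDiffOn_det {N : (Fin n → ℝ) → Matrix (Fin n) (Fin n) ℝ}
    (hN : ∀ i j, ContDiffOn ℝ 1 (fun y => N y i j) U) : ContDiffOn ℝ 1 (fun y => (N y).det) U := by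
  simp only [Matrix.det_apply]
  exact ContDiffOn.sum fun σ _ => (contDiffOn_prod fun i _ => hN _ _).const_smul _

theorem contDiffOn_inv_mulVec (hJ : ∀ i j, ContDiffOn ℝ 1 (fun y => J y i j) U)
    (hdet : ∀ y ∈ U, (J y).det ≠ 0) (hg : ∀ i, ContDiffOn ℝ 1 (g i) U) :
    ContDiffOn ℝ 1 (fun y => (J y)⁻¹ *ᵥ fun i => g i y) U := by
  refine contDiffOn_pi.2 fun i => ?_
  have h1 : ∀ y, ((J y)⁻¹ *ᵥ fun i => g i y) i
      = ∑ j, (J y).det⁻¹ * ((J y).updateRow j (Pi.single i 1)).det * g j y := fun y => by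
    simp [Matrix.mulVec, dotProduct, Matrix.inv_def, Matrix.adjugate_apply]
  simp only [h1]
  refine ContDiffOn.sum fun j _ => (((contDiffOn_det hJ).inv hdet).mul
    (contDiffOn_det fun k l => ?_)).mul (hg j)
  by_cases hk : k = j
  · subst hk; simpa using contDiffOn_const
  · simpa [Matrix.updateRow_ne hk] using hJ k l

/-- The Jacobian determinant of the solution of a linear system. -/
theorem det_mul_det_fderiv (hU : IsOpen U) (hJ : ∀ i j, ContDiffOn ℝ 1 (fun y => J y i j) U)
    (hdet : ∀ y ∈ U, (J y).det ≠ 0) (hg : ∀ i, ContDiffOn ℝ 1 (g i) U) (hx : x ∈ U) :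
    (J x).det * (fderiv ℝ (fun y => (J y)⁻¹ *ᵥ fun i => g i y) x).det
      = (Matrix.of fun i k => pd k (g i) x
        - ∑ j, pd k (fun y => J y i j) x * ((J x)⁻¹ *ᵥ fun i => g i x) j).det := by
  set Z : (Fin n → ℝ) → Fin n → ℝ := fun y => (J y)⁻¹ *ᵥ fun i => g i y with hZ
  have hd : DifferentiableAt ℝ Z x :=
    ((contDiffOn_inv_mulVec hJ hdet hg).contDiffAt (hU.mem_nhds hx)).differentiableAt one_ne_zero
  have hZj : ∀ j k, HasPd k (fun y => Z y j) (fderiv ℝ Z x (Pi.single k 1) j) x := fun j k => by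
    have := hasFDerivAt_pi'.1 hd.hasFDerivAt j
    exact ⟨this.differentiableAt, by rw [pd, this.fderiv]; rfl⟩
  rw [ContinuousLinearMap.det, ← LinearMap.det_toMatrix', ← Matrix.det_mul]
  congr 1
  ext i k
  have h1 := HasPd.sum (s := Finset.univ) fun j =>
    (((hJ i j).differentiableAt_of_isOpen hU one_ne_zero hx).hasPd k).mul (hZj j k)
  have h2 := (h1.congr (g := g i) hU hx fun y hy => by
    have h3 : J y *ᵥ Z y = fun i => g i y := by
      rw [hZ]
      simp only [Matrix.mulVec_mulVec]
      rw [Matrix.mul_nonsing_inv _ (isUnit_iff_ne_zero.2 (hdet y hy)), Matrix.one_mulVec]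
    exact congrFun h3 i).2
  simp only [Matrix.of_apply]
  rw [h2, Finset.sum_add_distrib, add_sub_cancel_left]
  simp [Matrix.mul_apply, LinearMap.toMatrix'_apply]

end MatrixMaps

theorem trace_mul_nonneg {n : ℕ} {G N : Matrix (Fin n) (Fin n) ℝ} (hG : G.PosSemidef)
    (hN : N.PosSemidef) : 0 ≤ (G * N).trace := by
  obtain ⟨B, hB⟩ : ∃ B : Matrix (Fin n) (Fin n) ℝ, G = B.conjTranspose * B := by
    open scoped MatrixOrder in
    obtain ⟨B, hB⟩ := CStarAlgebra.nonneg_iff_eq_star_mul_self.1 hG.nonneg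
    exact ⟨B, by rw [hB, Matrix.star_eq_conjTranspose]⟩
  have h := (hN.mul_mul_conjTranspose_same B).trace_nonneg
  rw [hB, Matrix.mul_assoc, Matrix.trace_mul_comm]
  exact h

/-- The Jacobian matrix of `∇u + T x`. -/
noncomputable def jmat {n : ℕ} (u : (Fin n → ℝ) → ℝ) (T : ℝ) (x : Fin n → ℝ) :
    Matrix (Fin n) (Fin n) ℝ :=
  (Matrix.of fun i j => pd i (pd j u) x) + T • (1 : Matrix (Fin n) (Fin n) ℝ)

/-- The Hessian at `x` of `w - z · (∇u + T x)`. -/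
noncomputable def cmat {n : ℕ} (u w : (Fin n → ℝ) → ℝ) (z x : Fin n → ℝ) :
    Matrix (Fin n) (Fin n) ℝ :=
  Matrix.of fun i k => pd k (pd i w) x - ∑ j, pd k (pd i (pd j u)) x * z j

/-- The slope map of the Alexandrov-Bakelman-Pucci argument. -/
noncomputable def slopeMap {n : ℕ} (u w : (Fin n → ℝ) → ℝ) (T : ℝ) (x : Fin n → ℝ) : Fin n → ℝ :=
  (jmat u T x)⁻¹.mulVec fun i => pd i w x

namespace IsSol

open Matrix

variable {n : ℕ} {K A M L b₀ T : ℝ} {u h ζ w : (Fin n → ℝ) → ℝ} {x z : Fin n → ℝ} {m : ℕ}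

theorem smooth_jmat (H : IsSol n K A M L u h) (i j : Fin n) :
    ContDiffOn ℝ 1 (fun y => jmat u T y i j) (ball 0 1) :=
  ((H.smooth_pd_pd i j).of_le (by norm_num)).add contDiffOn_const

theorem pd_jmat (H : IsSol n K A M L u h) (hx : x ∈ ball 0 1) (i j k : Fin n) :
    pd k (fun y => jmat u T y i j) x = pd k (pd i (pd j u)) x := by
  have := (((H.smooth_pd_pd i j).differentiableAt_of_isOpen isOpen_ball (by norm_num) hx).hasPd
    k).add (HasPd.const ((T • (1 : Matrix (Fin n) (Fin n) ℝ)) i j))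
  exact this.2.trans (add_zero _)

theorem det_jmat_pos (H : IsSol n K A M L u h) (hx : x ∈ ball 0 1) (hT0 : 0 < T)
    (hT : 2 * (2 * K + 2 * n * A) ≤ T) : 0 < (jmat u T x).det :=
  lt_of_lt_of_le (mul_pos (H.lap_pos' hx) (by positivity)) (H.det_hess_add_ge hx hT)

theorem smooth_slope (H : IsSol n K A M L u h) (hw : ContDiffOn ℝ 2 w (ball 0 1)) (hT0 : 0 < T)
    (hT : 2 * (2 * K + 2 * n * A) ≤ T) : ContDiffOn ℝ 1 (slopeMap u w T) (ball 0 1) :=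
  contDiffOn_inv_mulVec H.smooth_jmat (fun _ hy => (H.det_jmat_pos hy hT0 hT).ne')
    fun i => hw.pd isOpen_ball (by norm_num) i

theorem det_jmat_mul (H : IsSol n K A M L u h) (hw : ContDiffOn ℝ 2 w (ball 0 1)) (hT0 : 0 < T)
    (hT : 2 * (2 * K + 2 * n * A) ≤ T) (hx : x ∈ ball 0 1) :
    (jmat u T x).det * (fderiv ℝ (slopeMap u w T) x).det
      = (cmat u w (slopeMap u w T x) x).det := by
  refine (det_mul_det_fderiv isOpen_ball H.smooth_jmat
    (fun _ hy => (H.det_jmat_pos hy hT0 hT).ne')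
    (fun i => hw.pd (l := 1) isOpen_ball (by norm_num) i) hx).trans ?_
  simp only [H.pd_jmat hx]
  rfl

/-- First and second order conditions at a contact point. -/
theorem contact (H : IsSol n K A M L u h) (hw : ContDiffOn ℝ 2 w (ball 0 1)) (hx : x ∈ ball 0 1)
    (hT0 : 0 < T) (hT : 2 * (2 * K + 2 * n * A) ≤ T)
    (hm : IsLocalMax (fun y => w y - ∑ j, z j * (pd j u y + T * y j)) x) :
    slopeMap u w T x = z ∧ (-(cmat u w z x)).PosSemidef := by
  set F := fun y => w y - ∑ j, z j * (pd j u y + T * y j) with hF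
  have hx' := isOpen_ball.mem_nhds hx
  have hcoord : ∀ y : Fin n → ℝ, ∀ j i : Fin n,
      HasPd i (fun y : Fin n → ℝ => y j) ((1 : Matrix (Fin n) (Fin n) ℝ) i j) y := fun y j i =>
    ⟨by fun_prop, by
      rw [pd, (hasFDerivAt_apply (𝕜 := ℝ) j y).fderiv]
      simp [Matrix.one_apply, Pi.single_apply, eq_comm]⟩
  have hsF : ContDiffOn ℝ 2 F (ball 0 1) := by
    refine hw.sub (ContDiffOn.sum fun j _ => contDiffOn_const.mul
      (((H.smooth_pd j).of_le (by norm_num)).add (contDiffOn_const.mul ?_)))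
    fun_prop
  have h1 : ∀ y ∈ ball 0 1, ∀ i, HasPd i F (pd i w y - ∑ j, z j * (pd i (pd j u) y
      + T * (1 : Matrix (Fin n) (Fin n) ℝ) i j)) y := fun y hy i =>
    ((hw.differentiableAt_of_isOpen isOpen_ball (by norm_num) hy).hasPd i).sub
      (HasPd.sum fun j => ((H.hasPd_pd hy i j).add ((hcoord y j i).const_mul T)).const_mul (z j))
  have h2 : ∀ i k, pd k (pd i F) x = cmat u w z x i k := fun i k => by
    rw [pd_congr isOpen_ball hx fun y hy => (h1 y hy i).2]
    have h3 : ∀ j, HasPd k (pd i (pd j u)) (pd k (pd i (pd j u)) x) x := fun j =>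
      ((H.smooth_pd_pd i j).differentiableAt_of_isOpen isOpen_ball (by norm_num) hx).hasPd k
    refine (((((hw.pd (l := 1) isOpen_ball (by norm_num) i).differentiableAt_of_isOpen isOpen_ball
      one_ne_zero hx).hasPd k).sub (HasPd.sum fun j =>
        ((h3 j).add (HasPd.const _)).const_mul (z j))).2).trans ?_
    simp [cmat, mul_comm]
  constructor
  · have h3 : (fun i => pd i w x) = jmat u T x *ᵥ z := by
      ext i
      have h4 : pd i F x = 0 := by rw [pd, hm.fderiv_eq_zero]; rfl
      rw [(h1 x hx i).2] at h4
      rw [sub_eq_zero.1 h4]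
      simp only [jmat, Matrix.mulVec, dotProduct, Matrix.add_apply, Matrix.of_apply,
        Matrix.smul_apply, smul_eq_mul]
      exact Finset.sum_congr rfl fun j _ => by ring
    rw [slopeMap, h3, Matrix.mulVec_mulVec,
      Matrix.nonsing_inv_mul _ (isUnit_iff_ne_zero.2 (H.det_jmat_pos hx hT0 hT).ne'),
      Matrix.one_mulVec]
  · refine Matrix.PosSemidef.of_dotProduct_mulVec_nonneg ?_ fun v => ?_
    · ext i j
      simp only [Matrix.conjTranspose_apply, Matrix.neg_apply, star_trivial, ← h2]
      rw [pd_comm (hsF.contDiffAt hx')]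
    · have h4 := second_derivative_nonpos (hsF.contDiffAt hx') hm v
      rw [fderiv_fderiv_eq_sum (hsF.contDiffAt hx')] at h4
      have h5 : star v ⬝ᵥ (-(cmat u w z x)) *ᵥ v = -∑ i, ∑ j, v i * pd i (pd j F) x * v j := by
        simp only [dotProduct, Matrix.mulVec, Finset.mul_sum, Pi.star_apply, star_trivial,
          Matrix.neg_apply, ← Finset.sum_neg_distrib]
        exact Finset.sum_congr rfl fun i _ => Finset.sum_congr rfl fun j _ => by
          rw [pd_comm (hsF.contDiffAt hx') i j, h2]; ring
      rw [h5]
      linarith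

theorem trace_gmat_cmat_le (H : IsSol n K A M L u h) (hx : x ∈ ball 0 1) {ρ : ℝ}
    (hz : ∀ i, |z i| ≤ ρ) :
    (gmat u h x * -(cmat u w z x)).trace
      ≤ -(∑ i, ∑ j, gmat u h x i j * pd i (pd j w) x) + lap u x * (n * L * ρ) := by
  have h1 : (gmat u h x * -(cmat u w z x)).trace
      = -(∑ i, ∑ j, gmat u h x i j * pd i (pd j w) x)
        + ∑ k, z k * ∑ i, ∑ j, gmat u h x i j * pd k (pd i (pd j u)) x := by
    simp only [Matrix.trace, Matrix.diag_apply, Matrix.mul_apply, Matrix.neg_apply, cmat,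
      Matrix.of_apply, Finset.mul_sum]
    rw [sum_swap_left, sum_swap_right, ← Finset.sum_neg_distrib, ← Finset.sum_add_distrib]
    refine Finset.sum_congr rfl fun i _ => ?_
    rw [← Finset.sum_neg_distrib, ← Finset.sum_add_distrib]
    refine Finset.sum_congr rfl fun j _ => ?_
    rw [neg_sub, mul_sub, Finset.mul_sum, sub_eq_neg_add]
    congr 1
    refine Finset.sum_congr rfl fun k _ => ?_
    rw [H.pd_three_swap_right hx k i j, H.pd_three_swap_left hx k j i,
      H.pd_three_swap_right hx j k i, H.pd_three_swap_left hx j i k]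
    ring
  rw [h1]
  simp only [H.gmat_third hx]
  have hl := H.lap_pos' hx
  have h2 := abs_le.1 (abs_sum_mul_le hz (H.dh_le x hx))
  have h3 : ∑ k, z k * (pd k h x * lap u x) = lap u x * ∑ k, z k * pd k h x := by
    rw [Finset.mul_sum]; exact Finset.sum_congr rfl fun k _ => by ring
  rw [h3]
  have h4 := mul_le_mul_of_nonneg_left h2.2 hl.le
  linarith

/-- The Jacobian of the slope map at a contact point. -/
theorem abs_det_fderiv_slope_le (H : IsSol n K A M L u h) (hx : x ∈ ball 0 1) {ρ r R P : ℝ}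
    (hn : 1 ≤ n) (hζ : Cutoff n r R P ζ) (hthr : threshold n K A ≤ Real.exp b₀)
    (hdet : 2 * (K + (2 * K + 2 * n * A)) ≤ Real.exp b₀) (hv : b₀ ≤ logLap u x) (hT0 : 0 < T)
    (hT : 2 * (2 * K + 2 * n * A) ≤ T) (hz : ∀ i, |slopeMap u (abpFun m b₀ ζ u) T x i| ≤ ρ)
    (hN : (-(cmat u (abpFun m b₀ ζ u) (slopeMap u (abpFun m b₀ ζ u) T x) x)).PosSemidef) :
    |(fderiv ℝ (slopeMap u (abpFun m b₀ ζ u) T) x).det|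
      ≤ 2 * K ^ 2 * 4 ^ (n - 1) / T ^ (n - 1) * lap u x
        * (abpConst n m K A L P * (ζ x ^ m * (1 + (logLap u x - b₀))) + n * L * ρ) ^ n := by
  have hl := H.lap_pos' hx
  have hK := H.hK
  have hw : ContDiffOn ℝ 2 (abpFun m b₀ ζ u) (ball 0 1) := H.smooth_abpFun hζ.smooth
  have h1 := H.det_jmat_mul hw hT0 hT hx
  set w := abpFun m b₀ ζ u
  set N := cmat u w (slopeMap u w T x) x
  set D := (fderiv ℝ (slopeMap u w T) x).det
  have h2 := det_mul_le_trace_pow (H.gmat_posSemidef hx) hN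
  have hel : Real.exp b₀ ≤ lap u x := by
    rw [← Real.exp_log hl]; exact Real.exp_le_exp.2 hv
  have h3 := H.det_gmat_ge hx (hdet.trans hel)
  have h4 : lap u x * (T / 2) ^ (n - 1) ≤ (jmat u T x).det := H.det_hess_add_ge hx hT
  have hG0 : 0 < (gmat u h x).det := lt_of_lt_of_le (by positivity) h3
  have hJ0 := H.det_jmat_pos hx hT0 hT
  have h5 : |D| * (jmat u T x).det = (-N).det := by
    have h6 : 0 ≤ (-N).det := nonneg_of_mul_nonneg_left h2.1 hG0
    have h7 : |(-N).det| = |N.det| := by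
      rw [Matrix.det_neg, abs_mul, abs_pow, abs_neg, abs_one, one_pow, one_mul]
    rw [← abs_of_nonneg h6, h7, ← h1, abs_mul, abs_of_pos hJ0, mul_comm]
  have h6 := (H.trace_gmat_cmat_le hx hz).trans
    (add_le_add_left (H.neg_gmat_abpFun_le (m := m) hζ hx hthr hv) _)
  have h7 : (gmat u h x * -N).trace ≤ lap u x
      * (abpConst n m K A L P * (ζ x ^ m * (1 + (logLap u x - b₀))) + n * L * ρ) := by
    refine h6.trans (le_of_eq ?_); ring
  set t := abpConst n m K A L P * (ζ x ^ m * (1 + (logLap u x - b₀))) + n * L * ρ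
  have h8 : 0 ≤ (gmat u h x * -N).trace :=
    trace_mul_nonneg (H.gmat_posSemidef hx) hN
  have h9 := h2.2.trans (pow_le_pow_left₀ h8 h7 n)
  rw [← h5] at h9
  obtain ⟨p, rfl⟩ : ∃ p, n = p + 1 := ⟨n - 1, by omega⟩
  simp only [Nat.add_sub_cancel] at *
  have h10 : |D| * (lap u x * (T / 2) ^ p) * ((2 * K ^ 2 * lap u x)⁻¹ * (lap u x / 2) ^ p)
      ≤ (lap u x * t) ^ (p + 1) := by
    refine le_trans ?_ h9
    gcongr
  have h11 : |D| = |D| * (lap u x * (T / 2) ^ p) * ((2 * K ^ 2 * lap u x)⁻¹ * (lap u x / 2) ^ p)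
      * (2 * K ^ 2 * 4 ^ p / (T ^ p * lap u x ^ p)) := by
    have : (4 : ℝ) ^ p = 2 ^ p * 2 ^ p := by rw [← mul_pow]; norm_num
    simp only [div_pow, this]
    field_simp
  calc |D| = _ := h11
    _ ≤ (lap u x * t) ^ (p + 1) * (2 * K ^ 2 * 4 ^ p / (T ^ p * lap u x ^ p)) := by gcongr
    _ = _ := by
      rw [mul_pow, pow_succ (lap u x)]
      field_simp

end IsSol

/-- Volume form of the covering step of the Alexandrov-Bakelman-Pucci argument. -/
theorem two_mul_pow_le_integral {n : ℕ} {f : (Fin n → ℝ) → Fin n → ℝ} {g : (Fin n → ℝ) → ℝ}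
    {U Q : Set (Fin n → ℝ)} {r : ℝ} (hU : IsOpen U) (hUQ : U ⊆ Q) (hf : ContDiffOn ℝ 1 f U)
    (hg : ContinuousOn g U) (hg0 : ∀ x ∈ Q, 0 ≤ g x) (hQ : MeasurableSet Q)
    (hgi : MeasureTheory.IntegrableOn g Q) (hr : 0 < r)
    (hcov : ∀ z ∈ ball (0 : Fin n → ℝ) r, ∃ x ∈ U, f x = z ∧ |(fderiv ℝ f x).det| ≤ g x) :
    (2 * r) ^ n ≤ ∫ x in Q, g x := by
  have hfd : ContinuousOn (fderiv ℝ f) U := hf.continuousOn_fderiv_of_isOpen hU le_rfl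
  have hd : ContinuousOn (fun x => |(fderiv ℝ f x).det| - g x) U :=
    ((ContinuousLinearMap.continuous_det.comp_continuousOn hfd).abs).sub hg
  set S := U \ (U ∩ (fun x => |(fderiv ℝ f x).det| - g x) ⁻¹' Ioi 0) with hS
  have hSm : MeasurableSet S :=
    hU.measurableSet.diff (hd.isOpen_inter_preimage hU isOpen_Ioi).measurableSet
  have hSU : S ⊆ U := sdiff_subset
  have hSle : ∀ x ∈ S, |(fderiv ℝ f x).det| ≤ g x := fun x hx => by
    by_contra hc
    exact hx.2 ⟨hx.1, sub_pos.2 (not_le.1 hc)⟩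
  have hsub : ball (0 : Fin n → ℝ) r ⊆ f '' S := fun z hz => by
    obtain ⟨x, hx, hxz, hle⟩ := hcov z hz
    exact ⟨x, ⟨hx, fun hc => absurd (sub_pos.1 hc.2) (not_lt.2 hle)⟩, hxz⟩
  have h1 := MeasureTheory.addHaar_image_le_lintegral_abs_det_fderiv MeasureTheory.volume hSm
    (f := f) (f' := fderiv ℝ f) fun x hx =>
      ((hf.contDiffAt (hU.mem_nhds (hSU hx))).differentiableAt one_ne_zero).hasFDerivAt.hasFDerivWithinAt
  have h2 := (MeasureTheory.measure_mono (μ := MeasureTheory.volume) hsub).trans h1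
  rw [Real.volume_pi_ball _ hr, Fintype.card_fin] at h2
  have h3 : ∫⁻ x in S, ENNReal.ofReal |(fderiv ℝ f x).det|
      ≤ ENNReal.ofReal (∫ x in Q, g x) := by
    rw [MeasureTheory.ofReal_integral_eq_lintegral_ofReal hgi
      ((MeasureTheory.ae_restrict_iff' hQ).2 (Filter.Eventually.of_forall hg0))]
    exact (MeasureTheory.setLIntegral_mono' hSm fun x hx =>
      ENNReal.ofReal_le_ofReal (hSle x hx)).trans
        (MeasureTheory.lintegral_mono_set (hSU.trans hUQ))
  exact (ENNReal.ofReal_le_ofReal_iff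
    (MeasureTheory.setIntegral_nonneg hQ hg0)).1 (h2.trans h3)

theorem le_of_pow_le_mul_add {p : ℕ} {N E R T : ℝ} (hp : 1 ≤ p) (hN : 0 < N)
    (hR : 0 < R) (hT : 1 ≤ T) (hTE : 2 * N ^ (p + 1) * E ≤ T)
    (h : (R / (N * T)) ^ (p + 1) ≤ E / T ^ p * (R ^ p + (R / T) ^ (p + 1))) :
    R ≤ 2 * N ^ (p + 1) * E * T := by
  have hT0 : 0 < T := by linarith
  have h1 : R ^ (p + 1) ≤ N ^ (p + 1) * E * T * R ^ p + N ^ (p + 1) * E / T ^ p * R ^ (p + 1) := by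
    have h2 := mul_le_mul_of_nonneg_left h (by positivity : 0 ≤ (N * T) ^ (p + 1))
    refine (le_of_eq ?_).trans (h2.trans (le_of_eq ?_))
    · rw [div_pow, mul_div_cancel₀ _ (by positivity)]
    · rw [mul_pow, div_pow]
      field_simp
      ring
  have h2 : N ^ (p + 1) * E / T ^ p ≤ 1 / 2 := by
    rw [div_le_iff₀ (by positivity)]
    have : T ≤ T ^ p := le_self_pow₀ hT (by omega)
    linarith
  have h3 := mul_le_mul_of_nonneg_right h2 (by positivity : 0 ≤ R ^ (p + 1))
  have h4 : R ^ p * R ≤ R ^ p * (2 * N ^ (p + 1) * E * T) := by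
    rw [← pow_succ]; linarith
  exact le_of_mul_le_mul_left h4 (by positivity)

/-- The bound for the Jacobian in terms of the maximum `R` of the auxiliary function. -/
theorem jacobian_factor_le {p : ℕ} {c Z V R T L g : ℝ} (hc : 0 ≤ c) (hZ0 : 0 ≤ Z) (hZ1 : Z ≤ 1)
    (hV : 0 ≤ V) (hR : 1 ≤ R) (hw : Z ^ (2 * p + 2) * V ≤ R) (hT : 0 < T) (hL : 0 ≤ L)
    (hg : V - 1 ≤ g) (hg0 : 0 ≤ g) :
    (c * (Z ^ (2 * p) * (1 + V)) + L * (R / T)) ^ (p + 1)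
      ≤ 2 ^ p * (c ^ (p + 1) * 2 ^ p + L ^ (p + 1)) * (R ^ p + (R / T) ^ (p + 1)) * (2 + g) := by
  have h1 : (Z ^ (2 * p) * (1 + V)) ^ (p + 1) ≤ 2 ^ p * R ^ p * (2 + g) := by
    have e : (Z ^ (2 * p) * (1 + V)) ^ (p + 1)
        = (Z ^ (2 * p + 2) * (1 + V)) ^ p * (1 + V) := by
      rw [mul_pow, mul_pow, pow_succ (1 + V), ← mul_assoc, ← pow_mul, ← pow_mul]
      ring_nf
    rw [e, ← mul_pow]
    have h2 : Z ^ (2 * p + 2) * (1 + V) ≤ 2 * R := by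
      have := pow_le_one₀ (n := 2 * p + 2) hZ0 hZ1
      nlinarith
    refine mul_le_mul ?_ (by linarith) (by positivity) (by positivity)
    gcongr
  have h3 := add_pow_le (mul_nonneg hc (by positivity : 0 ≤ Z ^ (2 * p) * (1 + V)))
    (by positivity : 0 ≤ L * (R / T)) (p + 1)
  refine h3.trans ?_
  rw [Nat.add_sub_cancel, mul_pow c, mul_pow L]
  have h4 := mul_le_mul_of_nonneg_left h1 (by positivity : 0 ≤ c ^ (p + 1))
  have h5 : 0 ≤ L ^ (p + 1) * (R / T) ^ (p + 1) * (1 + g) := by positivity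
  have h6 : 0 ≤ L ^ (p + 1) * R ^ p * (2 + g) := by positivity
  have h7 : 0 ≤ c ^ (p + 1) * 2 ^ p * (R / T) ^ (p + 1) * (2 + g) := by positivity
  rw [mul_assoc, mul_assoc (2 ^ p)]
  refine mul_le_mul_of_nonneg_left ?_ (by positivity)
  linarith

namespace IsSol

variable {n : ℕ} {K A M L b₀ T : ℝ} {u h ζ : (Fin n → ℝ) → ℝ} {x x₀ z : Fin n → ℝ} {m : ℕ}

/-- Every small slope is attained at a point where the auxiliary function is positive. -/
theorem exists_contact (H : IsSol n K A M L u h) {r P ρ : ℝ} (hζ : Cutoff n r (1 / 4) P ζ)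
    (hT0 : 0 < T) (hT : 2 * (2 * K + 2 * n * A) ≤ T) (hx₀ : x₀ ∈ closedBall 0 (1 / 2))
    (hR : n * (ρ * (2 * M + T)) < abpFun m b₀ ζ u x₀) (hz : ∀ i, |z i| ≤ ρ) :
    ∃ x ∈ ball 0 (1 / 2), slopeMap u (abpFun m b₀ ζ u) T x = z ∧
      (-(cmat u (abpFun m b₀ ζ u) z x)).PosSemidef ∧ b₀ ≤ logLap u x := by
  have hsub : closedBall (0 : Fin n → ℝ) (1 / 2) ⊆ ball 0 1 := closedBall_subset_ball (by norm_num)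
  have hw : ContDiffOn ℝ 2 (abpFun m b₀ ζ u) (ball 0 1) := H.smooth_abpFun hζ.smooth
  have hM := H.hM
  have hFc : ContinuousOn (fun y => abpFun m b₀ ζ u y - ∑ j, z j * (pd j u y + T * y j))
      (closedBall 0 (1 / 2)) := by
    refine (hw.continuousOn.mono hsub).sub (continuousOn_finsetSum _ fun j _ =>
      continuousOn_const.mul (((H.smooth_pd j).continuousOn.mono hsub).add ?_))
    fun_prop
  obtain ⟨x, hx, hmax⟩ := (isCompact_closedBall (0 : Fin n → ℝ) (1 / 2)).exists_isMaxOn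
    ⟨x₀, hx₀⟩ hFc
  have h1 := hmax hx₀
  simp only [mem_ofPred_eq] at h1
  have hco : ∀ y ∈ closedBall (0 : Fin n → ℝ) (1 / 2), ∀ j, |y j| ≤ 1 / 2 := fun y hy j => by
    have := (norm_le_pi_norm y j).trans (mem_closedBall_zero_iff.1 hy)
    rwa [Real.norm_eq_abs] at this
  have h2 : ∑ j, z j * ((pd j u x₀ + T * x₀ j) - (pd j u x + T * x j))
      ≤ n * (ρ * (2 * M + T)) := by
    refine (Finset.sum_le_card_nsmul _ _ (ρ * (2 * M + T)) fun j _ => ?_).trans (by simp)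
    have a1 := abs_le.1 (H.du_le x₀ (hsub hx₀) j)
    have a2 := abs_le.1 (H.du_le x (hsub hx) j)
    have a3 := abs_le.1 (hco x₀ hx₀ j)
    have a4 := abs_le.1 (hco x hx j)
    have a5 : |(pd j u x₀ + T * x₀ j) - (pd j u x + T * x j)| ≤ 2 * M + T := by
      rw [abs_le]; constructor <;> nlinarith
    refine (le_abs_self _).trans ?_
    rw [abs_mul]
    exact mul_le_mul (hz j) a5 (abs_nonneg _) ((abs_nonneg _).trans (hz j))
  simp only [mul_sub, Finset.sum_sub_distrib] at h2
  have hpos : 0 < abpFun m b₀ ζ u x := by linarith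
  have hζx : x ∈ closedBall 0 (1 / 4) := by
    by_contra hc
    rw [abpFun, hζ.eq_zero x hc] at hpos
    simp at hpos
  have hxb : x ∈ ball (0 : Fin n → ℝ) (1 / 2) := closedBall_subset_ball (by norm_num) hζx
  have hloc := hmax.isLocalMax (Filter.mem_of_superset (isOpen_ball.mem_nhds hxb) ball_subset_closedBall)
  obtain ⟨c1, c2⟩ := H.contact hw (hsub hx) hT0 hT hloc
  refine ⟨x, hxb, c1, c2, ?_⟩
  exact (sub_pos.1 (pos_of_mul_pos_right hpos (pow_nonneg (hζ.nonneg x) _))).le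

end IsSol

namespace IsSol

theorem exists_logLap_bound (p : ℕ) (hp : 1 ≤ p) (K A M L : ℝ) :
    ∃ C : ℝ, ∀ u h : (Fin (p + 1) → ℝ) → ℝ, IsSol (p + 1) K A M L u h → logLap u 0 ≤ C := by
  set q := 2 * (K + (2 * K + 2 * (p + 1 : ℕ) * A)) with hq
  set b₀ := Real.log (max 1 (max q (threshold (p + 1) K A))) with hb₀
  have hmax1 : (1 : ℝ) ≤ max 1 (max q (threshold (p + 1) K A)) := le_max_left _ _
  have hexp : Real.exp b₀ = max 1 (max q (threshold (p + 1) K A)) :=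
    Real.exp_log (by linarith)
  have hb : 0 ≤ b₀ := Real.log_nonneg hmax1
  have hthr : threshold (p + 1) K A ≤ Real.exp b₀ := by
    rw [hexp]; exact (le_max_right _ _).trans (le_max_right _ _)
  have hdet : q ≤ Real.exp b₀ := by
    rw [hexp]; exact (le_max_left _ _).trans (le_max_right _ _)
  obtain ⟨CD, hCD⟩ := exists_energy_bound (p + 1) (M := M) (L := L) hb hthr
  obtain ⟨P, ζ, hζ⟩ := exists_cutoff (p + 1) (r := 1 / 8) (R := 1 / 4) (by norm_num) (by norm_num)
  set c := abpConst (p + 1) (2 * p) K A L P with hc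
  set E₀ := 2 * K ^ 2 * 4 ^ p * (2 ^ p * (c ^ (p + 1) * 2 ^ p + (L / 4) ^ (p + 1))) with hE₀
  set N : ℝ := 2 * (p + 1 : ℕ) with hN
  set T := 1 + |M| + |2 * (2 * K + 2 * (p + 1 : ℕ) * A)| + |2 * N ^ (p + 1) * (E₀ * |CD|)| with hTd
  refine ⟨b₀ + max 1 (2 * N ^ (p + 1) * (E₀ * |CD|) * T), fun u h H => ?_⟩
  have hK := H.hK
  have hL := H.hL
  have hA := H.hA
  have hM := H.hM
  have hPp := hζ.P_pos
  have hc0 : 0 ≤ c := by rw [hc, abpConst]; positivity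
  have hE0 : 0 ≤ E₀ := by positivity
  have hN0 : 0 < N := by rw [hN]; positivity
  have t1 := abs_nonneg M
  have t2 := abs_nonneg (2 * (2 * K + 2 * (p + 1 : ℕ) * A))
  have t3 := abs_nonneg (2 * N ^ (p + 1) * (E₀ * |CD|))
  have hT1 : 1 ≤ T := by linarith
  have hT0 : 0 < T := by linarith
  have hTM : M ≤ T := by linarith [le_abs_self M]
  have hTA : 2 * (2 * K + 2 * (p + 1 : ℕ) * A) ≤ T := by
    linarith [le_abs_self (2 * (2 * K + 2 * (p + 1 : ℕ) * A))]
  have hTE : 2 * N ^ (p + 1) * (E₀ * |CD|) ≤ T := by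
    linarith [le_abs_self (2 * N ^ (p + 1) * (E₀ * |CD|))]
  have hsub : closedBall (0 : Fin (p + 1) → ℝ) (1 / 2) ⊆ ball 0 1 :=
    closedBall_subset_ball (by norm_num)
  have hw : ContDiffOn ℝ 2 (abpFun (2 * p) b₀ ζ u) (ball 0 1) := H.smooth_abpFun hζ.smooth
  obtain ⟨x₀, hx₀, hmax⟩ := (isCompact_closedBall (0 : Fin (p + 1) → ℝ) (1 / 2)).exists_isMaxOn
    ⟨0, by simp⟩ (hw.continuousOn.mono hsub)
  set R := abpFun (2 * p) b₀ ζ u x₀ with hR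
  have h0 : logLap u 0 - b₀ ≤ R := by
    have h1 : abpFun (2 * p) b₀ ζ u 0 ≤ R := hmax (by simp : (0 : Fin (p + 1) → ℝ) ∈ _)
    rwa [abpFun, hζ.eq_one 0 (by simp), one_pow, one_mul] at h1
  suffices hRC : R ≤ max 1 (2 * N ^ (p + 1) * (E₀ * |CD|) * T) by linarith
  rcases le_or_gt R 1 with hR1 | hR1
  · exact hR1.trans (le_max_left _ _)
  refine le_trans ?_ (le_max_right _ _)
  have hR0 : 0 < R := by linarith
  refine le_of_pow_le_mul_add hp hN0 hR0 hT1 hTE ?_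
  obtain ⟨hgi, hgle⟩ := hCD u h H
  set κ := E₀ / T ^ p * (R ^ p + (R / T) ^ (p + 1)) with hκ
  have hκ0 : 0 ≤ κ := by positivity
  set r := R / (2 * N * T) with hr
  have hr0 : 0 < r := by positivity
  have hcov : ∀ z ∈ ball (0 : Fin (p + 1) → ℝ) r, ∃ x ∈ ball (0 : Fin (p + 1) → ℝ) (1 / 2),
      slopeMap u (abpFun (2 * p) b₀ ζ u) T x = z ∧
      |(fderiv ℝ (slopeMap u (abpFun (2 * p) b₀ ζ u) T) x).det|
        ≤ κ * (lap u x * (2 + ramp (logLap u x - b₀))) := by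
    intro z hz
    have hz' : ∀ i, |z i| ≤ r := fun i =>
      (norm_le_pi_norm z i).trans (mem_ball_zero_iff.1 hz).le
    have hgap : ((p + 1 : ℕ) : ℝ) * (r * (2 * M + T)) < R := by
      have e : ((p + 1 : ℕ) : ℝ) * (r * (3 * T)) = 3 / 4 * R := by
        rw [hr, hN]; field_simp; norm_num
      have : ((p + 1 : ℕ) : ℝ) * (r * (2 * M + T)) ≤ ((p + 1 : ℕ) : ℝ) * (r * (3 * T)) := by
        gcongr; linarith
      linarith
    obtain ⟨x, hx, hxz, hpsd, hv⟩ := H.exists_contact hζ hT0 hTA hx₀ hgap hz'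
    refine ⟨x, hx, hxz, ?_⟩
    have hx1 := hsub (ball_subset_closedBall hx)
    have hl := H.lap_pos' hx1
    have hwx : abpFun (2 * p) b₀ ζ u x ≤ R := hmax (ball_subset_closedBall hx)
    have h1 := H.abs_det_fderiv_slope_le (m := 2 * p) (ρ := r) hx1 (by omega) hζ hthr hdet hv hT0
      hTA (by rw [hxz]; exact hz') (by rw [hxz]; exact hpsd)
    have h2 := jacobian_factor_le (p := p) (T := T) (g := ramp (logLap u x - b₀)) hc0 (hζ.nonneg x)
      (hζ.le_one x) (sub_nonneg.2 hv) hR1.le hwx hT0 (by positivity : 0 ≤ L / 4)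
      (sub_one_le_ramp _) (ramp_nonneg _)
    have e : ((p + 1 : ℕ) : ℝ) * L * r = L / 4 * (R / T) := by
      rw [hr, hN]; field_simp; norm_num
    rw [e, Nat.add_sub_cancel] at h1
    refine h1.trans ((mul_le_mul_of_nonneg_left h2 (by positivity)).trans (le_of_eq ?_))
    rw [hκ, hE₀]
    ring
  have hlap : ContinuousOn (fun x => κ * (lap u x * (2 + ramp (logLap u x - b₀))))
      (ball 0 (1 / 2)) := by
    have hs : ball (0 : Fin (p + 1) → ℝ) (1 / 2) ⊆ ball 0 1 := ball_subset_ball (by norm_num)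
    exact continuousOn_const.mul ((H.smooth_lap.continuousOn.mono hs).mul
      (continuousOn_const.add (contDiff_ramp.continuous.comp_continuousOn
        ((H.smooth_logLap.continuousOn.mono hs).sub continuousOn_const))))
  have hvol := two_mul_pow_le_integral isOpen_ball ball_subset_closedBall
    ((H.smooth_slope hw hT0 hTA).mono (ball_subset_ball (by norm_num))) hlap
    (fun x hx => mul_nonneg hκ0 (mul_nonneg (H.lap_pos' (hsub hx)).le
      (add_nonneg zero_le_two (ramp_nonneg _)))) measurableSet_closedBall (hgi.const_mul κ) hr0 hcov
  rw [MeasureTheory.integral_const_mul] at hvol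
  have e1 : 2 * r = R / (N * T) := by rw [hr]; field_simp
  rw [e1] at hvol
  refine hvol.trans ((mul_le_mul_of_nonneg_left (hgle.trans (le_abs_self CD)) hκ0).trans
    (le_of_eq ?_))
  rw [hκ]
  ring

end IsSol

theorem abs_deriv_le_of_eventually_le {G U V : ℝ → ℝ} {G' U' V' a b : ℝ}
    (hG : HasDerivAt G G' 0) (hU : HasDerivAt U U' 0) (hV : HasDerivAt V V' 0)
    (h : ∀ᶠ t in nhds (0 : ℝ), |G t - G 0| ≤ a * (|t| + |U t - U 0|) + b * |V t - V 0|) :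
    |G'| ≤ a * (1 + |U'|) + b * |V'| := by
  rw [hasDerivAt_iff_tendsto_slope] at hG hU hV
  have h1 := ((tendsto_const_nhds (x := (1 : ℝ))).add hU.abs).const_mul a
  refine le_of_tendsto_of_tendsto hG.abs (h1.add (hV.abs.const_mul b)) ?_
  filter_upwards [h.filter_mono nhdsWithin_le_nhds, self_mem_nhdsWithin] with t ht ht0
  have ht1 : 0 < |t| := abs_pos.2 ht0
  simp only [slope_def_field, sub_zero, abs_div]
  rw [div_le_iff₀ ht1]
  refine ht.trans (le_of_eq ?_)
  field_simp

section Substitution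

variable {n : ℕ} {K M : ℝ} {u : (Fin n → ℝ) → ℝ} {F : (Fin n → ℝ) × ℝ → ℝ}
  {D : Set (Fin n → ℝ)} {x : Fin n → ℝ}

theorem hasPd_substitution (hD : IsOpen D) (hx : x ∈ D) (hF : ContDiffOn ℝ 1 F (D ×ˢ univ))
    (hu : DifferentiableAt ℝ u x) (k : Fin n) : HasPd k (fun y => F (y, u y))
      (fderivWithin ℝ F (D ×ˢ univ) (x, u x) (Pi.single k 1, pd k u x)) x := by
  have hp : (x, u x) ∈ D ×ˢ (univ : Set ℝ) := ⟨hx, trivial⟩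
  have ho : IsOpen (D ×ˢ (univ : Set ℝ)) := hD.prod isOpen_univ
  have h1 := ((hF.contDiffAt (ho.mem_nhds hp)).differentiableAt one_ne_zero).hasFDerivAt
  rw [← fderivWithin_of_isOpen ho hp] at h1
  have h2 := h1.comp x ((hasFDerivAt_id x).prodMk hu.hasFDerivAt)
  exact ⟨h2.differentiableAt, DFunLike.congr_fun h2.fderiv (Pi.single k 1)⟩

theorem norm_single_prod_le (k : Fin n) (t : ℝ) :
    ‖((Pi.single k 1 : Fin n → ℝ), t)‖ ≤ 1 + |t| := by
  rw [Prod.norm_def, Pi.norm_single, norm_one]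
  exact max_le (by simp) (by simp [Real.norm_eq_abs])

theorem abs_pd_substitution_le (hD : IsOpen D) (hx : x ∈ D) (hF : ContDiffOn ℝ 1 F (D ×ˢ univ))
    (hu : DifferentiableAt ℝ u x) (hK : 0 ≤ K)
    (hFK : ∀ p ∈ D ×ˢ univ, ‖fderivWithin ℝ F (D ×ˢ univ) p‖ ≤ K) (k : Fin n)
    (hM : |pd k u x| ≤ M) : |pd k (fun y => F (y, u y)) x| ≤ K * (1 + M) := by
  rw [(hasPd_substitution hD hx hF hu k).2]
  refine (ContinuousLinearMap.le_opNorm _ _).trans (mul_le_mul (hFK _ ⟨hx, trivial⟩)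
    ((norm_single_prod_le k _).trans (by linarith)) (norm_nonneg _) hK)

theorem hasDerivAt_line {f : (Fin n → ℝ) → ℝ} (hf : DifferentiableAt ℝ f x) (k : Fin n) :
    HasDerivAt (fun t : ℝ => f (x + t • Pi.single k 1)) (pd k f x) 0 := by
  have h1 : HasDerivAt (fun t : ℝ => x + t • (Pi.single k 1 : Fin n → ℝ)) (Pi.single k 1) 0 := by
    simpa using ((hasDerivAt_id (0 : ℝ)).smul_const (Pi.single k 1 : Fin n → ℝ)).const_add x
  have h2 : HasFDerivAt f (fderiv ℝ f x) (x + (0 : ℝ) • (Pi.single k 1 : Fin n → ℝ)) := by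
    simpa using hf.hasFDerivAt
  exact h2.comp_hasDerivAt 0 h1

theorem abs_pd_pd_substitution_le (hD : IsOpen D) (hx : x ∈ D)
    (hF : ContDiffOn ℝ 1 F (D ×ˢ univ)) (hu : ContDiffOn ℝ 2 u D) (hK : 0 ≤ K)
    (hFK : ∀ p ∈ D ×ˢ univ, ‖fderivWithin ℝ F (D ×ˢ univ) p‖ ≤ K)
    (hL : LipschitzOnWith K.toNNReal (fderivWithin ℝ F (D ×ˢ univ)) (D ×ˢ univ)) (k : Fin n)
    (hM : ∀ y ∈ D, |pd k u y| ≤ M)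
    (hd : DifferentiableAt ℝ (pd k fun y => F (y, u y)) x) :
    |pd k (pd k fun y => F (y, u y)) x|
      ≤ K * (1 + M) * (1 + |pd k u x|) + K * |pd k (pd k u) x| := by
  have hu' : ∀ y ∈ D, DifferentiableAt ℝ u y := fun y hy =>
    hu.differentiableAt_of_isOpen hD two_ne_zero hy
  have hM0 : 0 ≤ M := (abs_nonneg _).trans (hM x hx)
  refine abs_deriv_le_of_eventually_le (hasDerivAt_line hd k) (hasDerivAt_line (hu' x hx) k)
    (hasDerivAt_line ((hu.pd (l := 1) hD (by norm_num) k).differentiableAt_of_isOpen hD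
      one_ne_zero hx) k) ?_
  have hcont : Filter.Tendsto (fun t : ℝ => x + t • (Pi.single k 1 : Fin n → ℝ)) (nhds 0)
      (nhds x) := by
    have : Continuous fun t : ℝ => x + t • (Pi.single k 1 : Fin n → ℝ) := by fun_prop
    simpa using this.tendsto 0
  filter_upwards [hcont (hD.mem_nhds hx)] with t ht
  simp only [zero_smul, add_zero]
  set y := x + t • (Pi.single k 1 : Fin n → ℝ) with hy
  have hyD : y ∈ D := ht
  rw [(hasPd_substitution hD hx hF (hu' x hx) k).2, (hasPd_substitution hD hyD hF (hu' y hyD) k).2]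
  set Φ := fderivWithin ℝ F (D ×ˢ univ)
  have e : Φ (y, u y) (Pi.single k 1, pd k u y) - Φ (x, u x) (Pi.single k 1, pd k u x)
      = (Φ (y, u y) - Φ (x, u x)) (Pi.single k 1, pd k u y)
        + Φ (x, u x) (0, pd k u y - pd k u x) := by
    have : ((0 : Fin n → ℝ), pd k u y - pd k u x)
        = ((Pi.single k 1 : Fin n → ℝ), pd k u y) - (Pi.single k 1, pd k u x) := by simp
    rw [this, map_sub, sub_apply]
    ring
  rw [e]
  refine (abs_add_le _ _).trans (add_le_add ?_ ?_)
  · have h0 := (Φ (y, u y) - Φ (x, u x)).le_opNorm (Pi.single k 1, pd k u y)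
    rw [Real.norm_eq_abs] at h0
    refine h0.trans ?_
    have h1 := hL.norm_sub_le (show (y, u y) ∈ D ×ˢ (univ : Set ℝ) from ⟨hyD, trivial⟩)
      (show (x, u x) ∈ D ×ˢ (univ : Set ℝ) from ⟨hx, trivial⟩)
    rw [Real.coe_toNNReal _ hK] at h1
    have h2 : ‖(y, u y) - (x, u x)‖ ≤ |t| + |u y - u x| := by
      rw [Prod.mk_sub_mk, Prod.norm_def]
      refine max_le ?_ ?_
      · rw [hy, add_sub_cancel_left, norm_smul, Pi.norm_single, norm_one, mul_one, Real.norm_eq_abs]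
        linarith [abs_nonneg (u y - u x)]
      · rw [Real.norm_eq_abs]
        linarith [abs_nonneg t]
    calc _ ≤ (K * (|t| + |u y - u x|)) * (1 + M) :=
          mul_le_mul (h1.trans (mul_le_mul_of_nonneg_left h2 hK))
            ((norm_single_prod_le k _).trans (by linarith [hM y hyD])) (norm_nonneg _)
            (by positivity)
      _ = _ := by ring
  · refine ((Φ (x, u x)).le_opNorm _).trans (mul_le_mul (hFK _ ⟨hx, trivial⟩) ?_
      (norm_nonneg _) hK)
    rw [Prod.norm_def, norm_zero, max_eq_right (norm_nonneg _), Real.norm_eq_abs]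

end Substitution

/-- interior Hessian estimate in dimension `n ≥ 4` for semi-convex 2-convex
solutions of `(σ₂/σ₁)(λ(D²u)) = ψ(x,u)` in `B₁(0) ⊂ ℝⁿ`, with a constant depending only on
`n`, the semi-convexity constant `A`, bounds `K` on `‖ψ‖_{C^{1,1}}`, `‖1/ψ‖_{L^∞}` and `M` on
`‖u‖_{C¹(B₁(0))}`. -/
theorem stmt1 (n : ℕ) (hn : 4 ≤ n) (M K A : ℝ) (hM : 0 < M) (hK : 0 < K) (hA : 0 < A) :
    ∃ C : ℝ, 0 < C ∧
      ∀ (u : (Fin n → ℝ) → ℝ) (ψ : (Fin n → ℝ) → ℝ → ℝ),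
        -- u ∈ C⁴(B₁)
        ContDiffOn ℝ 4 u (ball 0 1) →
        -- ψ : B₁ × ℝ → (0, ∞) of class C^{1,1}
        (∀ x ∈ ball (0 : Fin n → ℝ) 1, ∀ s : ℝ, 0 < ψ x s) →
        ContDiffOn ℝ 1 (Function.uncurry ψ) (ball (0 : Fin n → ℝ) 1 ×ˢ (univ : Set ℝ)) →
        -- ‖ψ‖_{C^{1,1}} ≤ K
        (∀ p ∈ ball (0 : Fin n → ℝ) 1 ×ˢ (univ : Set ℝ),
          |Function.uncurry ψ p| ≤ K ∧
          ‖fderivWithin ℝ (Function.uncurry ψ)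
              (ball (0 : Fin n → ℝ) 1 ×ˢ (univ : Set ℝ)) p‖ ≤ K) →
        LipschitzOnWith (Real.toNNReal K)
          (fderivWithin ℝ (Function.uncurry ψ) (ball (0 : Fin n → ℝ) 1 ×ˢ (univ : Set ℝ)))
          (ball (0 : Fin n → ℝ) 1 ×ˢ (univ : Set ℝ)) →
        -- ‖1/ψ‖_{L^∞} ≤ K
        (∀ x ∈ ball (0 : Fin n → ℝ) 1, ∀ s : ℝ, 1 / ψ x s ≤ K) →
        -- ‖u‖_{C¹(B₁)} ≤ M
        (∀ x ∈ ball (0 : Fin n → ℝ) 1, |u x| + ‖fderiv ℝ u x‖ ≤ M) →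
        -- u is semi-convex: D²u ≥ −A·Id on B₁ (as quadratic forms)
        (∀ x ∈ ball (0 : Fin n → ℝ) 1, ∀ v : Fin n → ℝ,
          -A * ∑ i, (v i) ^ 2 ≤ ∑ i, ∑ j, v i * hessian n u x i j * v j) →
        -- u is 2-convex (λ(D²u) ∈ Γ₂) and solves (σ₂/σ₁)(D²u) = ψ(x,u)
        (∀ x ∈ ball (0 : Fin n → ℝ) 1,
          0 < lapl n u x ∧ 0 < sigma2 n u x ∧
            sigma2 n u x / lapl n u x = ψ x (u x)) →
        -- conclusion: |D²u(0)| ≤ C (entrywise bound on the Hessian at the origin)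
        ∀ i j, |hessian n u 0 i j| ≤ C := by
  obtain ⟨p, rfl⟩ : ∃ p, n = p + 1 := ⟨n - 1, by omega⟩
  obtain ⟨C, hC⟩ := IsSol.exists_logLap_bound p (by omega) K A M (K * (1 + M) ^ 2)
  refine ⟨Real.exp C, Real.exp_pos C, fun u ψ hu hψ0 hψ hψK hψL hψi huM hconv heq i j => ?_⟩
  have hpp : ∀ x ∈ ball (0 : Fin (p + 1) → ℝ) 1, ∀ i j,
      hessian (p + 1) u x i j = pd i (pd j u) x := fun x hx i j =>
    iteratedFDeriv_two_eq_pd_pd ((hu.contDiffAt (isOpen_ball.mem_nhds hx)).of_le (by norm_num)) i j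
  have hlap : ∀ x ∈ ball (0 : Fin (p + 1) → ℝ) 1, lapl (p + 1) u x = lap u x := fun x hx =>
    Finset.sum_congr rfl fun i _ => hpp x hx i i
  have hcomm : ∀ x ∈ ball (0 : Fin (p + 1) → ℝ) 1, ∀ i j, pd i (pd j u) x = pd j (pd i u) x :=
    fun x hx => pd_comm ((hu.contDiffAt (isOpen_ball.mem_nhds hx)).of_le (by norm_num))
  set h := fun x => Function.uncurry ψ (x, u x) with hh
  have hu2 : ∀ i j, ContDiffOn ℝ 2 (pd i (pd j u)) (ball 0 1) := fun i j =>
    (hu.pd (l := 3) isOpen_ball (by norm_num) j).pd isOpen_ball (by norm_num) i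
  have hlpos : ∀ x ∈ ball (0 : Fin (p + 1) → ℝ) 1, 0 < lap u x := fun x hx =>
    hlap x hx ▸ (heq x hx).1
  have hform : ∀ x ∈ ball (0 : Fin (p + 1) → ℝ) 1,
      h x = (lap u x ^ 2 - ∑ i, ∑ j, pd i (pd j u) x ^ 2) / 2 / lap u x := fun x hx => by
    change ψ x (u x) = _
    rw [← (heq x hx).2.2, sigma2, hlap x hx]
    refine congrArg (fun s => (lap u x ^ 2 - s) / 2 / lap u x) ?_
    refine Finset.sum_congr rfl fun i _ => Finset.sum_congr rfl fun j _ => ?_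
    rw [hpp x hx, hpp x hx, hcomm x hx j i, sq]
  have hh2 : ContDiffOn ℝ 2 h (ball 0 1) := by
    have hl : ContDiffOn ℝ 2 (lap u) (ball 0 1) := ContDiffOn.sum fun i _ => hu2 i i
    refine ContDiffOn.congr (ContDiffOn.div (((hl.pow 2).sub (ContDiffOn.sum fun i _ =>
      ContDiffOn.sum fun j _ => (hu2 i j).pow 2)).div_const 2) hl fun x hx => (hlpos x hx).ne')
      hform
  have hdu : ∀ x ∈ ball (0 : Fin (p + 1) → ℝ) 1, ∀ i, |pd i u x| ≤ M := fun x hx i => by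
    have h1 := (fderiv ℝ u x).le_opNorm (Pi.single i 1)
    rw [Pi.norm_single, norm_one, mul_one, Real.norm_eq_abs] at h1
    exact h1.trans (by linarith [huM x hx, abs_nonneg (u x)])
  have hud : ∀ x ∈ ball (0 : Fin (p + 1) → ℝ) 1, DifferentiableAt ℝ u x := fun x hx =>
    hu.differentiableAt_of_isOpen isOpen_ball (by norm_num) hx
  have H : IsSol (p + 1) K A M (K * (1 + M) ^ 2) u h :=
    { hK := hK
      hA := hA.le
      hM := hM
      hL := by positivity
      u_smooth := hu
      h_smooth := hh2
      h_lower := fun x hx => by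
        have h1 := hψi x hx (u x)
        rw [one_div] at h1
        exact inv_le_of_inv_le₀ (hψ0 x hx _) h1
      h_upper := fun x hx => (le_abs_self _).trans (hψK (x, u x) ⟨hx, trivial⟩).1
      lap_pos := hlpos
      eqn := fun x hx => by
        have h1 := hform x hx
        have h2 := hlpos x hx
        rw [div_div, eq_div_iff (by positivity)] at h1
        change _ = lap u x ^ 2 - 2 * h x * lap u x
        linarith
      convex := fun x hx v => by
        have h1 := hconv x hx v
        simpa only [hpp x hx] using h1
      du_le := hdu
      dh_le := fun x hx i => by
        refine (abs_pd_substitution_le isOpen_ball hx hψ (hud x hx) hK.le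
          (fun q hq => (hψK q hq).2) i (hdu x hx i)).trans ?_
        nlinarith [mul_pos hK hM]
      ddh_le := fun x hx i => by
        have h1 := abs_pd_pd_substitution_le isOpen_ball hx hψ (hu.of_le (by norm_num)) hK.le
          (fun q hq => (hψK q hq).2) hψL i (fun y hy => hdu y hy i)
          ((hh2.pd (l := 1) isOpen_ball (by norm_num) i).differentiableAt_of_isOpen isOpen_ball
            one_ne_zero hx)
        refine h1.trans ?_
        have h2 := mul_le_mul_of_nonneg_left (hdu x hx i) (by positivity : 0 ≤ K * (1 + M))
        have h3 : K ≤ K * (1 + M) ^ 2 := le_mul_of_one_le_right hK.le (one_le_pow₀ (by linarith))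
        have h4 := mul_le_mul_of_nonneg_right h3 (abs_nonneg (pd i (pd i u) x))
        linarith }
  have h0 : (0 : Fin (p + 1) → ℝ) ∈ ball 0 1 := by simp
  rw [hpp 0 h0]
  refine (H.abs_hess_le h0 i j).trans ?_
  rw [← Real.exp_log (hlpos 0 h0)]
  exact Real.exp_le_exp.2 (hC u h H)
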